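/- Let n ≥ 1, let a ∈ ℝ^n have pairwise distinct nonzero entries, let L ∈ {0,1}^n, and let s ∈ ℂ^n have pairwise distinct entries with Re(s_j − s_{j+1}) ≥ 1 for all j = 1,…,n (using the conventions s_{n+1} = −1, L_{n+1} = −1). Then N_{n,n}(s, L; diag(a)) = (∏_{j=0}^{n−1} j!) · det[ sign(a_c)^{L_b} · |a_c|^{s_b} ]_{b,c=1,…,n} / (Δ_n(a) · Δ_n(s)). -/

import Mathlib

open MeasureTheory Matrix Finset Filter

noncomputable section

namespace RMT

instance matMS (l m : ℕ) : MeasurableSpace (Matrix (Fin l) (Fin m) ℂ) :=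
  inferInstanceAs (MeasurableSpace (Fin l → Fin m → ℂ))

/-- The real part of the determinant of the leading principal `j × j` submatrix. -/
def pminor {l : ℕ} (y : Matrix (Fin l) (Fin l) ℂ) (j : ℕ) : ℝ :=
  (Matrix.det (Matrix.of fun p q : Fin (min j l) =>
    y (Fin.castLE (min_le_right j l) p) (Fin.castLE (min_le_right j l) q))).re

/-- `s_{j+1}` with the convention `s_{n+1} = -1` (0-based index `j`). -/
def sNext (n : ℕ) (s : ℕ → ℂ) (j : ℕ) : ℂ := if j + 1 < n then s (j + 1) else -1

/-- `L_{j+1}` with the convention `L_{n+1} = -1` (0-based index `j`). -/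
def LNext (n : ℕ) (L : ℕ → ℤ) (j : ℕ) : ℤ := if j + 1 < n then L (j + 1) else -1

/-- The integrand of the spherical function `N_{l,n}(s,L;·)`. -/
def sphProd (n : ℕ) (s : ℕ → ℂ) (L : ℕ → ℤ) {l : ℕ} (y : Matrix (Fin l) (Fin l) ℂ) : ℂ :=
  ∏ j ∈ Finset.range n,
    if pminor y (j + 1) = 0 then 0
    else ((Real.sign (pminor y (j + 1)) : ℂ) ^ (L j - LNext n L j - 1)) *
      (((|pminor y (j + 1)| : ℝ) : ℂ) ^ (s j - sNext n s j - 1))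

/-- The integrand of the normalization constant `C_{l,n}(s)`. -/
def absProd (n : ℕ) (s : ℕ → ℂ) {l : ℕ} (y : Matrix (Fin l) (Fin l) ℂ) : ℂ :=
  ∏ j ∈ Finset.range n,
    if pminor y (j + 1) = 0 then 0
    else (((|pminor y (j + 1)| : ℝ) : ℂ) ^ (s j - sNext n s j - 1))

/-- `μ` is the normalized Haar probability measure of `U(l)`, viewed as a measure on the
space of `l × l` complex matrices: it is a probability measure, it is carried by the
unitary group, and it is invariant under left translation by every unitary matrix.
(These properties determine `μ` uniquely.) -/
def IsHaarUnitary (l : ℕ) (μ : Measure (Matrix (Fin l) (Fin l) ℂ)) : Prop :=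
  IsProbabilityMeasure μ ∧ μ {A | A ∈ Matrix.unitaryGroup (Fin l) ℂ}ᶜ = 0 ∧
    ∀ U ∈ Matrix.unitaryGroup (Fin l) ℂ, μ.map (fun A => U * A) = μ

/-- `N_{l,n}(s, L; x)`. -/
def Nsph (l n : ℕ) (μ : Measure (Matrix (Fin l) (Fin l) ℂ)) (s : ℕ → ℂ) (L : ℕ → ℤ)
    (x : Matrix (Fin l) (Fin l) ℂ) : ℂ :=
  ∫ k, sphProd n s L (k * x * kᴴ) ∂μ

/-- The l×l diagonal matrix with `n` ones followed by zeros. -/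
def projMat (l n : ℕ) : Matrix (Fin l) (Fin l) ℂ :=
  Matrix.diagonal fun i => if (i : ℕ) < n then 1 else 0

/-- The normalization `C_{l,n}(s)`. -/
def Csph (l n : ℕ) (μ : Measure (Matrix (Fin l) (Fin l) ℂ)) (s : ℕ → ℂ) : ℂ :=
  ∫ k, absProd n s (k * projMat l n * kᴴ) ∂μ

/-- The spherical function `Φ_{l,n}(s,L;x) = N_{l,n}(s,L;x)/C_{l,n}(s)`. -/
def Phi (l n : ℕ) (μ : Measure (Matrix (Fin l) (Fin l) ℂ)) (s : ℕ → ℂ) (L : ℕ → ℤ)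
    (x : Matrix (Fin l) (Fin l) ℂ) : ℂ :=
  Nsph l n μ s L x / Csph l n μ s

/-- `L^{(n)} = ((n-1) mod 2, (n-2) mod 2, …, 1, 0)`. -/
def Lstd (n : ℕ) : ℕ → ℤ := fun j => ((n - 1 - j : ℕ) : ℤ) % 2

/-- The spherical function `Ψ(s; g) = Φ_{l,n}(s, L^{(n)}; g g*)` for `g` of rank `n`. -/
def Psi (l m n : ℕ) (μ : Measure (Matrix (Fin l) (Fin l) ℂ)) (s : ℕ → ℂ)
    (g : Matrix (Fin l) (Fin m) ℂ) : ℂ :=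
  Phi l n μ s (Lstd n) (g * gᴴ)

/-- The Vandermonde determinant `Δ_n(a) = ∏_{c>d} (a_c - a_d)` (complex version). -/
def VdmC (n : ℕ) (a : ℕ → ℂ) : ℂ := ∏ c ∈ Finset.range n, ∏ d ∈ Finset.range c, (a c - a d)

/-- The Vandermonde determinant `Δ_n(a) = ∏_{c>d} (a_c - a_d)` (real version). -/
def VdmR (n : ℕ) (a : ℕ → ℝ) : ℝ := ∏ c ∈ Finset.range n, ∏ d ∈ Finset.range c, (a c - a d)

end RMT

namespace RMT

instance matBorel (l m : ℕ) : BorelSpace (Matrix (Fin l) (Fin m) ℂ) :=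
  inferInstanceAs (BorelSpace (Fin l → Fin m → ℂ))

instance matSC (l m : ℕ) : SecondCountableTopology (Matrix (Fin l) (Fin m) ℂ) :=
  inferInstanceAs (SecondCountableTopology (Fin l → Fin m → ℂ))

instance matOpens (l m : ℕ) : OpensMeasurableSpace (Matrix (Fin l) (Fin m) ℂ) := inferInstance

lemma isClosed_unitary (l : ℕ) :
    IsClosed {A : Matrix (Fin l) (Fin l) ℂ | A ∈ Matrix.unitaryGroup (Fin l) ℂ} := by
  have : {A : Matrix (Fin l) (Fin l) ℂ | A ∈ Matrix.unitaryGroup (Fin l) ℂ} =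
      {A | A * star A = 1} := by
    ext A; exact Matrix.mem_unitaryGroup_iff
  rw [this]
  exact isClosed_eq (by fun_prop) continuous_const

lemma isCompact_unitary (l : ℕ) :
    IsCompact {A : Matrix (Fin l) (Fin l) ℂ | A ∈ Matrix.unitaryGroup (Fin l) ℂ} := by
  have hK : IsCompact (Set.pi Set.univ (fun _ : Fin l => Set.pi Set.univ
      (fun _ : Fin l => Metric.closedBall (0 : ℂ) 1))) :=
    isCompact_univ_pi (fun _ => isCompact_univ_pi (fun _ => isCompact_closedBall _ _))
  refine IsCompact.of_isClosed_subset hK (isClosed_unitary l) ?_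
  intro A hA i _ j _
  simpa using entry_norm_bound_of_unitary hA i j

lemma unitary_conjTranspose {l : ℕ} {U : Matrix (Fin l) (Fin l) ℂ}
    (hU : U ∈ Matrix.unitaryGroup (Fin l) ℂ) : Uᴴ ∈ Matrix.unitaryGroup (Fin l) ℂ :=
  Unitary.star_mem hU

/-- An invariance statement for lower integrals. -/
lemma haar_lintegral_left {l : ℕ} {μ : Measure (Matrix (Fin l) (Fin l) ℂ)}
    (hμ : IsHaarUnitary l μ) {U : Matrix (Fin l) (Fin l) ℂ}
    (hU : U ∈ Matrix.unitaryGroup (Fin l) ℂ)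
    {f : Matrix (Fin l) (Fin l) ℂ → ENNReal} (hf : Measurable f) :
    ∫⁻ k, f (U * k) ∂μ = ∫⁻ k, f k ∂μ := by
  conv_rhs => rw [← hμ.2.2 U hU]
  rw [lintegral_map hf]
  exact (by fun_prop : Continuous fun A => U * A).measurable

lemma haar_integral_left {l : ℕ} {μ : Measure (Matrix (Fin l) (Fin l) ℂ)}
    (hμ : IsHaarUnitary l μ) {U : Matrix (Fin l) (Fin l) ℂ}
    (hU : U ∈ Matrix.unitaryGroup (Fin l) ℂ)
    {f : Matrix (Fin l) (Fin l) ℂ → ℂ} (hf : Measurable f) :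
    ∫ k, f (U * k) ∂μ = ∫ k, f k ∂μ := by
  conv_rhs => rw [← hμ.2.2 U hU]
  rw [integral_map]
  · exact (by fun_prop : Continuous fun A => U * A).measurable.aemeasurable
  · exact hf.aestronglyMeasurable

lemma haar_ae {l : ℕ} {μ : Measure (Matrix (Fin l) (Fin l) ℂ)}
    (hμ : IsHaarUnitary l μ) : ∀ᵐ k ∂μ, k ∈ Matrix.unitaryGroup (Fin l) ℂ := by
  rw [ae_iff]; exact hμ.2.1

lemma haar_star_right {l : ℕ} {μ : Measure (Matrix (Fin l) (Fin l) ℂ)}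
    (hμ : IsHaarUnitary l μ) {U : Matrix (Fin l) (Fin l) ℂ}
    (hU : U ∈ Matrix.unitaryGroup (Fin l) ℂ)
    {f : Matrix (Fin l) (Fin l) ℂ → ENNReal} (hf : Measurable f) :
    ∫⁻ k, f (kᴴ * U) ∂μ = ∫⁻ k, f kᴴ ∂μ := by
  have := haar_lintegral_left hμ (unitary_conjTranspose hU) (f := fun k => f kᴴ)
    (hf.comp (by fun_prop : Continuous fun A : Matrix (Fin l) (Fin l) ℂ => Aᴴ).measurable)
  simpa using this

/-- The measure is invariant under conjugate transposition. -/
lemma haar_lintegral_star {l : ℕ} {μ : Measure (Matrix (Fin l) (Fin l) ℂ)}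
    (hμ : IsHaarUnitary l μ)
    {f : Matrix (Fin l) (Fin l) ℂ → ENNReal} (hf : Measurable f) :
    ∫⁻ k, f kᴴ ∂μ = ∫⁻ k, f k ∂μ := by
  have := hμ.1
  have h1 : ∫⁻ h, ∫⁻ k, f (hᴴ * k) ∂μ ∂μ = ∫⁻ k, f k ∂μ := by
    have : ∀ᵐ h ∂μ, ∫⁻ k, f (hᴴ * k) ∂μ = ∫⁻ k, f k ∂μ := by
      filter_upwards [haar_ae hμ] with h hh
      exact haar_lintegral_left hμ (unitary_conjTranspose hh) hf
    rw [lintegral_congr_ae this]; simp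
  have h2 : ∫⁻ k, ∫⁻ h, f (hᴴ * k) ∂μ ∂μ = ∫⁻ k, f kᴴ ∂μ := by
    have : ∀ᵐ k ∂μ, ∫⁻ h, f (hᴴ * k) ∂μ = ∫⁻ k, f kᴴ ∂μ := by
      filter_upwards [haar_ae hμ] with h hh
      exact haar_star_right hμ hh hf
    rw [lintegral_congr_ae this]; simp
  rw [← h1, ← h2, lintegral_lintegral_swap]
  refine (hf.comp (Continuous.measurable ?_)).aemeasurable
  fun_prop

lemma haar_map_right {l : ℕ} {μ : Measure (Matrix (Fin l) (Fin l) ℂ)}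
    (hμ : IsHaarUnitary l μ) {U : Matrix (Fin l) (Fin l) ℂ}
    (hU : U ∈ Matrix.unitaryGroup (Fin l) ℂ) : μ.map (fun A => A * U) = μ := by
  have hm : Measurable (fun A : Matrix (Fin l) (Fin l) ℂ => A * U) :=
    (by fun_prop : Continuous fun A : Matrix (Fin l) (Fin l) ℂ => A * U).measurable
  refine Measure.ext_of_lintegral _ fun f hf => ?_
  rw [lintegral_map hf hm]
  refine (haar_lintegral_star hμ (hf.comp hm)).symm.trans ?_
  exact (haar_star_right hμ hU hf).trans (haar_lintegral_star hμ hf)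

lemma haar_integral_right {l : ℕ} {μ : Measure (Matrix (Fin l) (Fin l) ℂ)}
    (hμ : IsHaarUnitary l μ) {U : Matrix (Fin l) (Fin l) ℂ}
    (hU : U ∈ Matrix.unitaryGroup (Fin l) ℂ)
    {f : Matrix (Fin l) (Fin l) ℂ → ℂ} (hf : Measurable f) :
    ∫ k, f (k * U) ∂μ = ∫ k, f k ∂μ := by
  conv_rhs => rw [← haar_map_right hμ hU]
  rw [integral_map]
  · exact (by fun_prop : Continuous fun A => A * U).measurable.aemeasurable
  · exact hf.aestronglyMeasurable

lemma exists_haar (l : ℕ) : ∃ ν : Measure (Matrix (Fin l) (Fin l) ℂ), IsHaarUnitary l ν := by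
  have : CompactSpace (Matrix.unitaryGroup (Fin l) ℂ) :=
    isCompact_iff_compactSpace.mp (isCompact_unitary l)
  have : BorelSpace (Matrix.unitaryGroup (Fin l) ℂ) := Subtype.borelSpace _
  let ν : Measure (Matrix.unitaryGroup (Fin l) ℂ) := Measure.haarMeasure ⊤
  have hν : IsProbabilityMeasure ν := ⟨by
    have := Measure.haarMeasure_self (K₀ := (⊤ : TopologicalSpace.PositiveCompacts (Matrix.unitaryGroup (Fin l) ℂ)))
    simpa using this⟩
  have hv : Measurable (Subtype.val : Matrix.unitaryGroup (Fin l) ℂ → _) := measurable_subtype_coe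
  refine ⟨ν.map Subtype.val, ?_, ?_, ?_⟩
  · exact Measure.isProbabilityMeasure_map hv.aemeasurable
  · rw [Measure.map_apply hv (isClosed_unitary l).measurableSet.compl]
    convert measure_empty (μ := ν)
    ext x; simp
  · intro U hU
    have hm : Measurable (fun A : Matrix (Fin l) (Fin l) ℂ => U * A) :=
      (by fun_prop : Continuous fun A : Matrix (Fin l) (Fin l) ℂ => U * A).measurable
    rw [Measure.map_map hm hv]
    have h1 := map_mul_left_eq_self ν ⟨U, hU⟩
    conv_rhs => rw [← h1]
    rw [Measure.map_map hv (measurable_const_mul _)]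
    rfl

end RMT

namespace RMT

/-- The power function occurring in the integrand. -/
def gpow (L : ℤ) (s : ℂ) (u : ℝ) : ℂ :=
  if u = 0 then 0 else ((Real.sign u : ℝ) : ℂ) ^ L * ((|u| : ℝ) : ℂ) ^ s

lemma measurable_sign : Measurable Real.sign := by
  unfold Real.sign
  exact Measurable.ite measurableSet_Iio measurable_const
    (Measurable.ite measurableSet_Ioi measurable_const measurable_const)

lemma measurable_gpow (L : ℤ) (s : ℂ) : Measurable (gpow L s) := by
  unfold gpow
  refine Measurable.ite (measurableSet_singleton 0) measurable_const (Measurable.mul ?_ ?_)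
  · exact (Complex.measurable_ofReal.comp measurable_sign).pow_const L
  · exact (Complex.measurable_ofReal.comp measurable_abs).pow_const s

lemma norm_gpow {L : ℤ} {s : ℂ} {u : ℝ} (hu : u ≠ 0) : ‖gpow L s u‖ = |u| ^ s.re := by
  have h1 : ‖((Real.sign u : ℝ) : ℂ)‖ = 1 := by
    rcases Real.sign_apply_eq_of_ne_zero u hu with h | h <;> simp [h]
  rw [gpow, if_neg hu, norm_mul, norm_zpow, h1, _root_.one_zpow, one_mul,
    Complex.norm_cpow_eq_rpow_re_of_pos (abs_pos.mpr hu)]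

lemma norm_gpow_le {L : ℤ} {s : ℂ} (hs : 0 ≤ s.re) {u B : ℝ} (hB : |u| ≤ B) :
    ‖gpow L s u‖ ≤ B ^ s.re := by
  have hB0 : 0 ≤ B := (abs_nonneg u).trans hB
  by_cases hu : u = 0
  · simp [gpow, hu]; positivity
  · rw [norm_gpow hu]; gcongr

lemma gpow_mul {L : ℤ} {s : ℂ} (u v : ℝ) : gpow L s (u * v) = gpow L s u * gpow L s v := by
  by_cases hu : u = 0
  · simp [gpow, hu]
  by_cases hv : v = 0
  · simp [gpow, hv]
  have hs : Real.sign (u * v) = Real.sign u * Real.sign v := by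
    rcases lt_or_gt_of_ne hu with h | h <;> rcases lt_or_gt_of_ne hv with h' | h' <;>
    simp [Real.sign_of_neg, Real.sign_of_pos, h, h', mul_pos_of_neg_of_neg,
      mul_neg_of_neg_of_pos, mul_neg_of_pos_of_neg]
  simp only [gpow, hu, hv, mul_eq_zero, or_self, if_false]
  rw [hs, abs_mul]
  push_cast
  rw [mul_zpow, Complex.mul_cpow_ofReal_nonneg (abs_nonneg _) (abs_nonneg _)]
  ring

lemma gpow_prod {L : ℤ} {s : ℂ} {ι : Type*} (S : Finset ι) (u : ι → ℝ) :
    gpow L s (∏ i ∈ S, u i) = ∏ i ∈ S, gpow L s (u i) := by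
  classical
  induction S using Finset.induction_on with
  | empty => simp [gpow]
  | insert i S hi ih => rw [Finset.prod_insert hi, Finset.prod_insert hi, gpow_mul, ih]

lemma gpow_add {L M : ℤ} {s t : ℂ} {u : ℝ} (hu : u ≠ 0) :
    gpow (L + M) (s + t) u = gpow L s u * gpow M t u := by
  have h1 : ((Real.sign u : ℝ) : ℂ) ≠ 0 := by
    rcases Real.sign_apply_eq_of_ne_zero u hu with h | h <;> simp [h]
  have h2 : ((|u| : ℝ) : ℂ) ≠ 0 := by simpa using hu
  simp only [gpow, hu, if_false]
  rw [zpow_add₀ h1, Complex.cpow_add _ _ h2]; ring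

lemma sphProd_eq (n : ℕ) (s : ℕ → ℂ) (L : ℕ → ℤ) {l : ℕ} (y : Matrix (Fin l) (Fin l) ℂ) :
    sphProd n s L y = ∏ j ∈ Finset.range n,
      gpow (L j - LNext n L j - 1) (s j - sNext n s j - 1) (pminor y (j + 1)) := rfl

lemma continuous_pminor (l j : ℕ) :
    Continuous (fun y : Matrix (Fin l) (Fin l) ℂ => pminor y j) := by
  unfold pminor
  refine Complex.continuous_re.comp (Continuous.matrix_det ?_)
  refine continuous_matrix fun p q => ?_
  exact (continuous_apply_apply _ _ : Continuous fun y : Matrix (Fin l) (Fin l) ℂ => _)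

lemma measurable_sphProd (n l : ℕ) (s : ℕ → ℂ) (L : ℕ → ℤ) :
    Measurable (fun y : Matrix (Fin l) (Fin l) ℂ => sphProd n s L y) := by
  simp only [sphProd_eq]
  refine Finset.measurable_prod _ fun j _ => ?_
  exact (measurable_gpow _ _).comp (continuous_pminor l _).measurable

lemma sphProd_bdd (n l : ℕ) (s : ℕ → ℂ) (L : ℕ → ℤ)
    (hs : ∀ j < n, 1 ≤ (s j - sNext n s j).re) (x : Matrix (Fin l) (Fin l) ℂ) :
    ∃ C, ∀ k ∈ Matrix.unitaryGroup (Fin l) ℂ, ‖sphProd n s L (k * x * kᴴ)‖ ≤ C := by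
  have hb : ∀ j, ∃ B, ∀ k ∈ Matrix.unitaryGroup (Fin l) ℂ, |pminor (k * x * kᴴ) j| ≤ B := by
    intro j
    have := (isCompact_unitary l).exists_bound_of_continuousOn
      (f := fun k => pminor (k * x * kᴴ) j)
      ((continuous_pminor l j).comp (by fun_prop)).continuousOn
    simpa using this
  choose B hB using hb
  refine ⟨∏ j ∈ Finset.range n, (B (j + 1)) ^ (s j - sNext n s j - 1).re, fun k hk => ?_⟩
  rw [sphProd_eq, norm_prod]
  refine Finset.prod_le_prod (fun _ _ => norm_nonneg _) fun j hj => ?_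
  refine norm_gpow_le ?_ (hB _ k hk)
  have := hs j (Finset.mem_range.mp hj)
  rw [Complex.sub_re, Complex.one_re]; linarith

lemma pminor_of_le {l j : ℕ} (h : j ≤ l) (y : Matrix (Fin l) (Fin l) ℂ) :
    pminor y j = (Matrix.det (y.submatrix (Fin.castLE h) (Fin.castLE h))).re := by
  unfold pminor
  have key : ∀ (i : ℕ) (hi : i ≤ l), i = j →
      (Matrix.det (Matrix.of fun p q : Fin i => y (Fin.castLE hi p) (Fin.castLE hi q))).re =
      (Matrix.det (y.submatrix (Fin.castLE h) (Fin.castLE h))).re := by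
    rintro i hi rfl; rfl
  exact key _ _ (min_eq_left h)

/-- The leading corner of codimension one. -/
def corner {m : ℕ} (y : Matrix (Fin (m + 1)) (Fin (m + 1)) ℂ) : Matrix (Fin m) (Fin m) ℂ :=
  y.submatrix Fin.castSucc Fin.castSucc

lemma continuous_corner (m : ℕ) : Continuous (corner (m := m)) := by
  refine continuous_matrix fun p q => ?_
  exact (continuous_apply_apply _ _ : Continuous fun y : Matrix (Fin _) (Fin _) ℂ => _)

lemma pminor_corner {m j : ℕ} (h : j ≤ m) (y : Matrix (Fin (m + 1)) (Fin (m + 1)) ℂ) :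
    pminor (corner y) j = pminor y j := by
  rw [pminor_of_le h, pminor_of_le (h.trans (Nat.le_succ m))]
  rfl

lemma pminor_full {m : ℕ} (y : Matrix (Fin m) (Fin m) ℂ) :
    pminor y m = (Matrix.det y).re := by
  rw [pminor_of_le le_rfl]; rfl

lemma sphProd_succ (m : ℕ) (s : ℕ → ℂ) (L : ℕ → ℤ) (y : Matrix (Fin (m + 1)) (Fin (m + 1)) ℂ) :
    sphProd (m + 1) s L y =
      sphProd m (fun j => s j - s m - 1) (fun j => L j - L m - 1) (corner y) *
        gpow (L m) (s m) (Matrix.det y).re := by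
  rw [sphProd_eq, sphProd_eq, Finset.prod_range_succ]
  congr 1
  · refine Finset.prod_congr rfl fun j hj => ?_
    have hj := Finset.mem_range.mp hj
    rw [pminor_corner (by omega)]
    simp only [LNext, sNext]
    rcases Nat.lt_or_ge (j + 1) m with h | h
    · rw [if_pos (by omega), if_pos (by omega), if_pos h, if_pos h]; congr 1 <;> ring
    · obtain rfl : m = j + 1 := by omega
      simp
  · rw [pminor_full]; simp [LNext, sNext]

/-- Extension of a matrix by one in the last corner. -/
def ext1 {m : ℕ} (h : Matrix (Fin m) (Fin m) ℂ) : Matrix (Fin (m + 1)) (Fin (m + 1)) ℂ :=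
  Matrix.reindex finSumFinEquiv finSumFinEquiv (Matrix.fromBlocks h 0 0 (1 : Matrix (Fin 1) (Fin 1) ℂ))

lemma continuous_ext1 (m : ℕ) : Continuous (ext1 (m := m)) := by
  unfold ext1
  simp only [Matrix.reindex_apply]
  fun_prop

lemma ext1_unitary {m : ℕ} {h : Matrix (Fin m) (Fin m) ℂ}
    (hh : h ∈ Matrix.unitaryGroup (Fin m) ℂ) : ext1 h ∈ Matrix.unitaryGroup (Fin (m + 1)) ℂ := by
  rw [Matrix.mem_unitaryGroup_iff] at hh ⊢
  rw [star_eq_conjTranspose] at hh ⊢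
  simp only [ext1, Matrix.reindex_apply, Matrix.conjTranspose_submatrix,
    Matrix.submatrix_mul_equiv, Matrix.fromBlocks_conjTranspose, Matrix.fromBlocks_multiply]
  simp [hh]

lemma corner_ext1 {m : ℕ} (h : Matrix (Fin m) (Fin m) ℂ)
    (y : Matrix (Fin (m + 1)) (Fin (m + 1)) ℂ) :
    corner (ext1 h * y * (ext1 h)ᴴ) = h * corner y * hᴴ := by
  obtain ⟨z, rfl⟩ := (Matrix.reindex finSumFinEquiv finSumFinEquiv).surjective y
  obtain ⟨A, B, C, D, rfl⟩ : ∃ A B C D, z = Matrix.fromBlocks A B C D :=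
    ⟨_, _, _, _, (Matrix.fromBlocks_toBlocks z).symm⟩
  simp only [ext1, Matrix.reindex_apply, Matrix.conjTranspose_submatrix,
    Matrix.submatrix_mul_equiv, Matrix.fromBlocks_conjTranspose, Matrix.fromBlocks_multiply]
  have key : ∀ A B C D, corner ((Matrix.fromBlocks A B C D).submatrix
      (finSumFinEquiv (m := m) (n := 1)).symm (finSumFinEquiv (m := m) (n := 1)).symm) = A := by
    intro A B C D
    ext i j
    have : ∀ i : Fin m, (finSumFinEquiv (m := m) (n := 1)).symm i.castSucc = Sum.inl i := by
      intro i; rw [Equiv.symm_apply_eq]; rfl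
    simp [corner, this]
  rw [key, key]
  simp

end RMT

namespace RMT

lemma sphProd_corner {m n : ℕ} (h : n ≤ m) (s : ℕ → ℂ) (L : ℕ → ℤ)
    (y : Matrix (Fin (m + 1)) (Fin (m + 1)) ℂ) :
    sphProd n s L (corner y) = sphProd n s L y := by
  rw [sphProd_eq, sphProd_eq]
  refine Finset.prod_congr rfl fun j hj => ?_
  have hj := Finset.mem_range.mp hj
  rw [pminor_corner (by omega)]

lemma step_shift {m : ℕ} {s : ℕ → ℂ} (hs : ∀ j < m + 1, 1 ≤ (s j - sNext (m + 1) s j).re) :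
    ∀ j < m, 1 ≤ ((fun j => s j - s m - 1) j - sNext m (fun j => s j - s m - 1) j).re := by
  intro j hj
  have := hs j (by omega)
  simp only [sNext] at this ⊢
  rw [if_pos (by omega)] at this
  rcases Nat.lt_or_ge (j + 1) m with h | h
  · rw [if_pos h]; simpa using this
  · obtain rfl : m = j + 1 := by omega
    simpa using this

lemma det_unitary_conj {l : ℕ} {k : Matrix (Fin l) (Fin l) ℂ}
    (hk : k ∈ Matrix.unitaryGroup (Fin l) ℂ) (x : Matrix (Fin l) (Fin l) ℂ) :
    det (k * x * kᴴ) = det x := by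
  have h1 : k * kᴴ = 1 := Matrix.mem_unitaryGroup_iff.mp hk
  have h2 : det k * det kᴴ = 1 := by rw [← det_mul, h1, det_one]
  rw [det_mul, det_mul, mul_right_comm, h2, one_mul]

lemma Nsph_rec {m : ℕ} {μ : Measure (Matrix (Fin (m + 1)) (Fin (m + 1)) ℂ)}
    (hμ : IsHaarUnitary (m + 1) μ) {ν : Measure (Matrix (Fin m) (Fin m) ℂ)}
    (hν : IsHaarUnitary m ν) (s : ℕ → ℂ) (L : ℕ → ℤ)
    (hs : ∀ j < m + 1, 1 ≤ (s j - sNext (m + 1) s j).re)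
    (x : Matrix (Fin (m + 1)) (Fin (m + 1)) ℂ) :
    Nsph (m + 1) (m + 1) μ s L x =
      (∫ k, Nsph m m ν (fun j => s j - s m - 1) (fun j => L j - L m - 1)
        (corner (k * x * kᴴ)) ∂μ) * gpow (L m) (s m) (det x).re := by
  have := hμ.1
  have := hν.1
  set s' : ℕ → ℂ := fun j => s j - s m - 1 with hs'
  set L' : ℕ → ℤ := fun j => L j - L m - 1 with hL'
  set f : Matrix (Fin (m + 1)) (Fin (m + 1)) ℂ → ℂ :=
    fun k => sphProd m s' L' (corner (k * x * kᴴ)) with hf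
  have hfm : Measurable f := (measurable_sphProd m m s' L').comp
    ((continuous_corner m).comp (by fun_prop)).measurable
  obtain ⟨C, hC⟩ := sphProd_bdd m (m + 1) s' L' (step_shift hs) x
  have hC' : ∀ k ∈ Matrix.unitaryGroup (Fin (m + 1)) ℂ, ‖f k‖ ≤ C := by
    intro k hk
    simp only [hf, sphProd_corner le_rfl]
    exact hC k hk
  have h1 : Nsph (m + 1) (m + 1) μ s L x =
      (∫ k, f k ∂μ) * gpow (L m) (s m) (det x).re := by
    rw [Nsph, ← integral_mul_const]
    refine integral_congr_ae ?_
    filter_upwards [haar_ae hμ] with k hk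
    rw [sphProd_succ, det_unitary_conj hk]
  rw [h1]
  congr 1
  have h2 : ∫ h, ∫ k, f (ext1 h * k) ∂μ ∂ν = ∫ k, f k ∂μ := by
    have : ∀ᵐ h ∂ν, ∫ k, f (ext1 h * k) ∂μ = ∫ k, f k ∂μ := by
      filter_upwards [haar_ae hν] with h hh
      exact haar_integral_left hμ (ext1_unitary hh) hfm
    rw [integral_congr_ae this]; simp
  rw [← h2, integral_integral_swap]
  · refine integral_congr_ae (ae_of_all _ fun k => ?_)
    simp only [Nsph, hf]
    refine integral_congr_ae (ae_of_all _ fun h => ?_)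
    simp only [← corner_ext1, conjTranspose_mul]
    congr 2
    simp only [Matrix.mul_assoc]
  · have hcont : Continuous (fun p : Matrix (Fin m) (Fin m) ℂ ×
        Matrix (Fin (m + 1)) (Fin (m + 1)) ℂ => ext1 p.1 * p.2) :=
      ((continuous_ext1 m).comp continuous_fst).matrix_mul continuous_snd
    refine Integrable.of_bound (C := C) ?_ ?_
    · exact (hfm.comp hcont.measurable).aestronglyMeasurable
    · filter_upwards [Measure.quasiMeasurePreserving_fst.ae (haar_ae hν),
        Measure.quasiMeasurePreserving_snd.ae (haar_ae hμ)] with p hp1 hp2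
      exact hC' _ (mul_mem (ext1_unitary hp1) hp2)

lemma Nsph_conj {l n : ℕ} {μ : Measure (Matrix (Fin l) (Fin l) ℂ)}
    (hμ : IsHaarUnitary l μ) (s : ℕ → ℂ) (L : ℕ → ℤ) {U : Matrix (Fin l) (Fin l) ℂ}
    (hU : U ∈ Matrix.unitaryGroup (Fin l) ℂ) (x : Matrix (Fin l) (Fin l) ℂ) :
    Nsph l n μ s L (U * x * Uᴴ) = Nsph l n μ s L x := by
  have := haar_integral_right hμ hU (f := fun k => sphProd n s L (k * x * kᴴ))
    ((measurable_sphProd n l s L).comp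
      (by fun_prop : Continuous fun k : Matrix (Fin l) (Fin l) ℂ => k * x * kᴴ).measurable)
  rw [Nsph, Nsph, ← this]
  refine integral_congr_ae (ae_of_all _ fun k => ?_)
  simp only [conjTranspose_mul, Matrix.mul_assoc]

lemma Nsph_congr {l n : ℕ} {μ : Measure (Matrix (Fin l) (Fin l) ℂ)}
    (hμ : IsHaarUnitary l μ) (s : ℕ → ℂ) (L : ℕ → ℤ) {x y : Matrix (Fin l) (Fin l) ℂ}
    (hx : x.IsHermitian) (hy : y.IsHermitian) (h : x.charpoly = y.charpoly) :
    Nsph l n μ s L x = Nsph l n μ s L y := by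
  have he := (hx.eigenvalues_eq_eigenvalues_iff hy).mpr h
  have key : ∀ {x : Matrix (Fin l) (Fin l) ℂ} (hx : x.IsHermitian), Nsph l n μ s L x =
      Nsph l n μ s L (diagonal (RCLike.ofReal ∘ hx.eigenvalues)) := by
    intro x hx
    conv_lhs => rw [hx.spectral_theorem, Unitary.conjStarAlgAut_apply]
    exact Nsph_conj hμ s L hx.eigenvectorUnitary.2 _
  rw [key hx, key hy, he]

lemma adjugate_unitary {l : ℕ} {k : Matrix (Fin l) (Fin l) ℂ}
    (hk : k ∈ Matrix.unitaryGroup (Fin l) ℂ) : adjugate k = det k • kᴴ := by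
  have h1 : k * kᴴ = 1 := Matrix.mem_unitaryGroup_iff.mp hk
  calc adjugate k = adjugate k * (k * kᴴ) := by rw [h1, Matrix.mul_one]
    _ = det k • kᴴ := by rw [← Matrix.mul_assoc, adjugate_mul, smul_mul, Matrix.one_mul]

lemma corner_charpoly_eval {m : ℕ} {k : Matrix (Fin (m + 1)) (Fin (m + 1)) ℂ}
    (hk : k ∈ Matrix.unitaryGroup (Fin (m + 1)) ℂ) (a : Fin (m + 1) → ℂ) (z : ℂ) :
    (corner (k * diagonal a * kᴴ)).charpoly.eval z =
      ∑ i, ((‖k (Fin.last m) i‖ ^ 2 : ℝ) : ℂ) * ∏ j ∈ univ.erase i, (z - a j) := by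
  have h1 : k * kᴴ = 1 := Matrix.mem_unitaryGroup_iff.mp hk
  have h2 : det k * det kᴴ = 1 := by rw [← det_mul, h1, det_one]
  have e1 : scalar (Fin m) z - corner (k * diagonal a * kᴴ) =
      corner (k * diagonal (fun i => z - a i) * kᴴ) := by
    have : diagonal (fun i => z - a i) = scalar (Fin (m + 1)) z - diagonal a := by
      rw [scalar_apply, diagonal_sub]
    rw [this, Matrix.mul_sub, Matrix.sub_mul]
    have : k * scalar (Fin (m + 1)) z * kᴴ = scalar (Fin (m + 1)) z := by
      rw [scalar_apply, ← smul_one_eq_diagonal, Matrix.mul_smul, Matrix.mul_one, Matrix.smul_mul, h1]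
    rw [this]
    ext i j
    simp [corner, diagonal_apply]
  rw [eval_charpoly, e1]
  have e2 : det (corner (k * diagonal (fun i => z - a i) * kᴴ)) =
      adjugate (k * diagonal (fun i => z - a i) * kᴴ) (Fin.last m) (Fin.last m) := by
    rw [adjugate_fin_succ_eq_det_submatrix]
    simp [corner, Fin.succAbove_last, ← two_mul]
  rw [e2, adjugate_mul_distrib, adjugate_mul_distrib, adjugate_unitary hk,
    adjugate_unitary (unitary_conjTranspose hk), adjugate_diagonal]
  simp only [conjTranspose_conjTranspose, Matrix.smul_mul, Matrix.mul_smul, smul_smul]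
  rw [h2, one_smul, ← Matrix.mul_assoc, Matrix.mul_apply]
  refine Finset.sum_congr rfl fun i _ => ?_
  rw [mul_diagonal, conjTranspose_apply]
  have : ((‖k (Fin.last m) i‖ ^ 2 : ℝ) : ℂ) =
      k (Fin.last m) i * star (k (Fin.last m) i) := by
    rw [Complex.star_def, Complex.mul_conj, Complex.normSq_eq_norm_sq]
  rw [this]; ring

end RMT

namespace RMT

/-- Lebesgue measure on the positive half-line. -/
def posLeb : Measure ℝ := (volume : Measure ℝ).restrict (Set.Ioi 0)

instance : SigmaFinite posLeb := by unfold posLeb; infer_instance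

lemma map_normSq : (volume : Measure ℂ).map (fun z => ‖z‖ ^ 2) =
    (NNReal.pi : ENNReal) • posLeb := by
  have hm : Measurable (fun z : ℂ => ‖z‖ ^ 2) := by fun_prop
  symm
  have : IsLocallyFiniteMeasure ((NNReal.pi : ENNReal) • posLeb) := by
    have : (NNReal.pi : ENNReal) • posLeb = NNReal.pi • posLeb := rfl
    rw [this, posLeb]
    infer_instance
  refine Measure.ext_of_Ico _ _ fun a b hab => ?_
  rw [Measure.map_apply hm measurableSet_Ico, Measure.smul_apply, posLeb,
    Measure.restrict_congr_set Ioi_ae_eq_Ici, Measure.restrict_apply measurableSet_Ico,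
    Set.Ico_inter_Ici, Real.volume_Ico]
  have : (fun z : ℂ => ‖z‖ ^ 2) ⁻¹' Set.Ico a b =
      Metric.ball (0 : ℂ) (√b) \ Metric.ball (0 : ℂ) (√a) := by
    ext z
    simp only [Set.mem_preimage, Set.mem_Ico, Set.mem_sdiff, mem_ball_zero_iff, 
      Real.lt_sqrt (norm_nonneg z), not_lt]
    tauto
  rw [this, measure_sdiff (Metric.ball_subset_ball (Real.sqrt_le_sqrt hab.le))
    measurableSet_ball.nullMeasurableSet (by simp [Complex.volume_ball, ENNReal.mul_eq_top])]
  rw [Complex.volume_ball, Complex.volume_ball, ENNReal.ofReal_sub _ (le_max_right _ _),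
    smul_eq_mul, ENNReal.mul_sub (by simp), mul_comm]
  have h : ∀ c : ℝ, ENNReal.ofReal (√c) ^ 2 = ENNReal.ofReal (max c 0) := by
    intro c
    rw [← ENNReal.ofReal_pow (Real.sqrt_nonneg c), Real.sq_sqrt']
  have h' : ENNReal.ofReal (max b 0) = ENNReal.ofReal b := by
    rcases le_total b 0 with h | h <;> simp [h, ENNReal.ofReal_of_nonpos]
  rw [h, h, h']
  congr 1
  exact mul_comm _ _

lemma pi_smul_const {n : ℕ} (c : NNReal) :
    Measure.pi (fun _ : Fin n => (c : ENNReal) • posLeb) =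
      ((c : ENNReal) ^ n) • Measure.pi (fun _ : Fin n => posLeb) := by
  have : SigmaFinite ((c : ENNReal) • posLeb) := by
    have : (c : ENNReal) • posLeb = c • posLeb := rfl
    rw [this]; infer_instance
  refine Measure.pi_eq fun s hs => ?_
  simp [Finset.prod_mul_distrib]

lemma lintegral_normSq {n : ℕ} {H : (Fin n → ℝ) → ENNReal} (hH : Measurable H) :
    ∫⁻ z : Fin n → ℂ, H (fun i => ‖z i‖ ^ 2) =
      (NNReal.pi : ENNReal) ^ n * ∫⁻ t, H t ∂(Measure.pi (fun _ : Fin n => posLeb)) := by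
  have : SigmaFinite ((NNReal.pi : ENNReal) • posLeb) := by
    have : (NNReal.pi : ENNReal) • posLeb = NNReal.pi • posLeb := rfl
    rw [this]; infer_instance
  have hmp : MeasurePreserving (fun z : ℂ => ‖z‖ ^ 2) volume ((NNReal.pi : ENNReal) • posLeb) :=
    ⟨by fun_prop, map_normSq⟩
  have := measurePreserving_pi (fun _ : Fin n => (volume : Measure ℂ))
    (fun _ : Fin n => (NNReal.pi : ENNReal) • posLeb) (fun _ => hmp)
  rw [pi_smul_const] at this
  have h2 := this.lintegral_comp hH
  rw [lintegral_smul_measure] at h2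
  exact h2

/-- Squared Euclidean norm. -/
def sqn {n : ℕ} (z : Fin n → ℂ) : ℝ := ∑ i, ‖z i‖ ^ 2

lemma sqn_eq {n : ℕ} (z : Fin n → ℂ) : ((sqn z : ℝ) : ℂ) = z ⬝ᵥ star z := by
  simp only [sqn, dotProduct, Pi.star_apply, Complex.star_def, Complex.mul_conj,
    Complex.normSq_eq_norm_sq]
  push_cast; rfl

lemma sqn_vecMul {n : ℕ} {k : Matrix (Fin n) (Fin n) ℂ}
    (hk : k ∈ Matrix.unitaryGroup (Fin n) ℂ) (z : Fin n → ℂ) : sqn (z ᵥ* k) = sqn z := by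
  have h1 : k * kᴴ = 1 := Matrix.mem_unitaryGroup_iff.mp hk
  apply Complex.ofReal_injective
  rw [sqn_eq, sqn_eq, star_vecMul, ← dotProduct_mulVec, mulVec_mulVec, h1, one_mulVec]

lemma sqn_pos {n : ℕ} {z : Fin n → ℂ} (hz : z ≠ 0) : 0 < sqn z := by
  obtain ⟨i, hi⟩ := Function.ne_iff.mp hz
  refine Finset.sum_pos' (fun _ _ => by positivity) ⟨i, mem_univ _, ?_⟩
  have : 0 < ‖z i‖ := norm_pos_iff.mpr hi
  positivity

lemma map_vecMul_volume {n : ℕ} {k : Matrix (Fin n) (Fin n) ℂ}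
    (hk : k ∈ Matrix.unitaryGroup (Fin n) ℂ) :
    (volume : Measure (Fin n → ℂ)).map (fun z => z ᵥ* k) = volume := by
  have h1 : k * kᴴ = 1 := Matrix.mem_unitaryGroup_iff.mp hk
  have h2 : det k * star (det k) = 1 := by rw [← det_conjTranspose, ← det_mul, h1, det_one]
  let f : (Fin n → ℂ) →ₗ[ℝ] (Fin n → ℂ) := (Matrix.toLin' kᵀ).restrictScalars ℝ
  have hf : LinearMap.det f = 1 := by
    rw [LinearMap.det_restrictScalars, LinearMap.det_toLin', det_transpose,
      Algebra.norm_complex_eq]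
    have : ((Complex.normSq (det k) : ℝ) : ℂ) = 1 := by rw [← Complex.mul_conj]; exact h2
    exact_mod_cast this
  have := Measure.map_linearMap_addHaar_eq_smul_addHaar (volume : Measure (Fin n → ℂ))
    (f := f) (by rw [hf]; exact one_ne_zero)
  rw [hf] at this
  simp only [inv_one, abs_one, ENNReal.ofReal_one, one_smul] at this
  conv_rhs => rw [← this]
  congr 1
  ext z : 1
  simp [f, Matrix.toLin'_apply, mulVec_transpose]

lemma exists_unitary_row {m : ℕ} {z : Fin (m + 1) → ℂ} (hz : z ≠ 0) :
    ∃ U ∈ Matrix.unitaryGroup (Fin (m + 1)) ℂ,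
      ∀ i, z i = ((√(sqn z) : ℝ) : ℂ) * U (Fin.last m) i := by
  have hp := sqn_pos hz
  have hs : 0 < √(sqn z) := Real.sqrt_pos.mpr hp
  let v : EuclideanSpace ℂ (Fin (m + 1)) := WithLp.toLp 2 (fun i => ((√(sqn z) : ℝ) : ℂ)⁻¹ * z i)
  have hv : ‖v‖ = 1 := by
    rw [EuclideanSpace.norm_eq]
    simp only [v, norm_mul, norm_inv, Complex.norm_real, Real.norm_eq_abs, abs_of_pos hs, mul_pow,
      ← Finset.mul_sum]
    rw [← sqn, inv_pow, Real.sq_sqrt hp.le, inv_mul_cancel₀ hp.ne', Real.sqrt_one]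
  have ho : Orthonormal ℂ (({Fin.last m} : Set (Fin (m + 1))).domRestrict
      (fun _ : Fin (m + 1) => v)) := by
    constructor
    · intro i; exact hv
    · intro i j hij
      exact absurd (Subsingleton.elim i j) hij
  obtain ⟨b, hb⟩ := ho.exists_orthonormalBasis_extension_of_card_eq (by simp)
  refine ⟨Matrix.of fun i j => b i j, ?_, fun i => ?_⟩
  · rw [Matrix.mem_unitaryGroup_iff]
    ext i j
    have := (orthonormal_iff_ite.mp b.orthonormal) j i
    rw [star_eq_conjTranspose, Matrix.mul_apply]
    simp only [Matrix.of_apply, conjTranspose_apply]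
    rw [EuclideanSpace.inner_eq_star_dotProduct] at this
    rw [Matrix.one_apply]
    simp only [eq_comm (a := i)]
    rw [← this]
    rfl
  · rw [Matrix.of_apply, hb _ (Set.mem_singleton _)]
    simp only [v]
    rw [mul_inv_cancel_left₀]
    exact_mod_cast hs.ne'

lemma lintegral_exp_one (n : ℕ) :
    ∫⁻ t, ENNReal.ofReal (Real.exp (-∑ i, t i)) ∂(Measure.pi (fun _ : Fin n => posLeb)) = 1 := by
  have hi : Integrable (fun x : ℝ => Real.exp (-x)) posLeb := integrableOn_exp_neg_Ioi 0
  have h1 : ∀ t : Fin n → ℝ, Real.exp (-∑ i, t i) = ∏ i, Real.exp (-t i) := by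
    intro t; rw [← Real.exp_sum, Finset.sum_neg_distrib]
  simp only [h1]
  rw [← ofReal_integral_eq_lintegral_ofReal
    (Integrable.fintype_prod (f := fun (_ : Fin n) (x : ℝ) => Real.exp (-x)) (fun _ => hi))
    (ae_of_all _ fun t => by positivity)]
  have h2 := integral_fintype_prod_eq_prod (μ := fun _ : Fin n => posLeb)
    (fun (_ : Fin n) (x : ℝ) => Real.exp (-x))
  rw [h2]
  simp only [posLeb, integral_exp_neg_Ioi_zero]
  simp

lemma row_lintegral {m : ℕ} {μ : Measure (Matrix (Fin (m + 1)) (Fin (m + 1)) ℂ)}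
    (hμ : IsHaarUnitary (m + 1) μ) {φ : (Fin (m + 1) → ℝ) → ENNReal} (hφ : Measurable φ) :
    ∫⁻ k, φ (fun i => ‖k (Fin.last m) i‖ ^ 2) ∂μ =
      ∫⁻ t, φ (fun i => t i / ∑ j, t j) * ENNReal.ofReal (Real.exp (-∑ i, t i))
        ∂(Measure.pi (fun _ : Fin (m + 1) => posLeb)) := by
  have := hμ.1
  set I := ∫⁻ k, φ (fun i => ‖k (Fin.last m) i‖ ^ 2) ∂μ with hI
  let ψ : (Fin (m + 1) → ℂ) → ENNReal := fun z => φ (fun i => ‖z i‖ ^ 2 / sqn z)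
  let g : (Fin (m + 1) → ℂ) → ENNReal := fun z => ENNReal.ofReal (Real.exp (-sqn z))
  have hsqn : Measurable (sqn : (Fin (m + 1) → ℂ) → ℝ) := by unfold sqn; fun_prop
  have hψ : Measurable ψ := hφ.comp (by fun_prop)
  have hg : Measurable g := by fun_prop
  have hcont : Continuous (fun p : (Fin (m + 1) → ℂ) × Matrix (Fin (m + 1)) (Fin (m + 1)) ℂ =>
      p.1 ᵥ* p.2) := by fun_prop
  have h2 : ∀ z : Fin (m + 1) → ℂ, z ≠ 0 → ∫⁻ k, ψ (z ᵥ* k) ∂μ = I := by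
    intro z hz
    obtain ⟨U, hU, hzU⟩ := exists_unitary_row hz
    have hp := sqn_pos hz
    have hm : Measurable (fun k : Matrix (Fin (m + 1)) (Fin (m + 1)) ℂ =>
        φ (fun i => ‖k (Fin.last m) i‖ ^ 2)) := by
      refine hφ.comp (measurable_pi_lambda _ fun i => ?_)
      exact (continuous_apply_apply (Fin.last m) i : Continuous
        fun k : Matrix (Fin (m + 1)) (Fin (m + 1)) ℂ => _).measurable.norm.pow_const 2
    rw [hI, ← haar_lintegral_left hμ hU hm]
    refine lintegral_congr_ae ?_
    filter_upwards [haar_ae hμ] with k hk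
    simp only [ψ, sqn_vecMul hk]
    congr 1
    ext i
    have : (z ᵥ* k) i = ((√(sqn z) : ℝ) : ℂ) * (U * k) (Fin.last m) i := by
      simp only [vecMul, dotProduct, Matrix.mul_apply, Finset.mul_sum]
      refine Finset.sum_congr rfl fun j _ => ?_
      rw [hzU j, mul_assoc]
    rw [this, norm_mul, mul_pow, Complex.norm_real, Real.norm_eq_abs, sq_abs, Real.sq_sqrt hp.le]
    field_simp
  have h3 : ∀ k ∈ Matrix.unitaryGroup (Fin (m + 1)) ℂ,
      ∫⁻ z, ψ (z ᵥ* k) * g z = ∫⁻ z, ψ z * g z := by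
    intro k hk
    conv_rhs => rw [← map_vecMul_volume hk]
    rw [lintegral_map (f := fun z => ψ z * g z) (hψ.mul hg)
      (by fun_prop : Continuous fun z : Fin (m + 1) → ℂ => z ᵥ* k).measurable]
    refine lintegral_congr fun z => ?_
    simp only [g, sqn_vecMul hk]
  have h4 : ∫⁻ z, I * g z = ∫⁻ z, ψ z * g z := by
    calc ∫⁻ z, I * g z = ∫⁻ z, ∫⁻ k, ψ (z ᵥ* k) * g z ∂μ := by
          refine lintegral_congr_ae ?_
          have : ∀ᵐ z : Fin (m + 1) → ℂ, z ≠ 0 := by simp [ae_iff]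
          filter_upwards [this] with z hz
          rw [lintegral_mul_const, h2 z hz]
          exact hψ.comp (hcont.measurable.comp measurable_prodMk_left)
      _ = ∫⁻ k, (∫⁻ z, ψ (z ᵥ* k) * g z) ∂μ := by
          rw [lintegral_lintegral_swap]
          exact ((hψ.comp hcont.measurable).mul (hg.comp measurable_fst)).aemeasurable
      _ = ∫⁻ z, ψ z * g z := by
          have : ∀ᵐ k ∂μ, ∫⁻ z, ψ (z ᵥ* k) * g z = ∫⁻ z, ψ z * g z := by
            filter_upwards [haar_ae hμ] with k hk
            exact h3 k hk
          rw [lintegral_congr_ae this]; simp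
  rw [lintegral_const_mul _ hg] at h4
  have e1 := lintegral_normSq (n := m + 1)
    (H := fun t => ENNReal.ofReal (Real.exp (-∑ i, t i))) (by fun_prop)
  have e2 := lintegral_normSq (n := m + 1)
    (H := fun t => φ (fun i => t i / ∑ j, t j) * ENNReal.ofReal (Real.exp (-∑ i, t i)))
    (by
      refine Measurable.mul (hφ.comp ?_) (by fun_prop)
      fun_prop)
  rw [lintegral_exp_one, mul_one] at e1
  have e1' : ∫⁻ z, g z = (NNReal.pi : ENNReal) ^ (m + 1) := e1
  have e2' : ∫⁻ z, ψ z * g z = _ := e2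
  rw [e1', e2', mul_comm] at h4
  have hpi : (NNReal.pi : ENNReal) ^ (m + 1) ≠ 0 := by
    simp [NNReal.pi_ne_zero]
  have hpi' : (NNReal.pi : ENNReal) ^ (m + 1) ≠ ⊤ := by simp
  exact (ENNReal.mul_right_inj hpi hpi').mp h4

end RMT

namespace RMT

/-- The weights attached to an interlacing pair. -/
def wt {m : ℕ} (a : Fin (m + 1) → ℝ) (b : Fin m → ℝ) (i : Fin (m + 1)) : ℝ :=
  ∏ j : Fin m, (a i - b j) / (a i - a (i.succAbove j))

/-- The box of points interlacing with `a`. -/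
def box {m : ℕ} (a : Fin (m + 1) → ℝ) : Set (Fin m → ℝ) :=
  Set.univ.pi fun j => Set.Ioo (a j.castSucc) (a j.succ)

lemma box_strictMono {m : ℕ} {a : Fin (m + 1) → ℝ} (ha : StrictMono a) {b : Fin m → ℝ}
    (hb : b ∈ box a) : StrictMono b := by
  intro i j hij
  have h1 := (hb i (Set.mem_univ _)).2
  have h2 := (hb j (Set.mem_univ _)).1
  have : a i.succ ≤ a j.castSucc := ha.monotone (by
    rw [Fin.le_def]; simp; omega)
  linarith

lemma wt_pos {m : ℕ} {a : Fin (m + 1) → ℝ} (ha : StrictMono a) {b : Fin m → ℝ}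
    (hb : b ∈ box a) (i : Fin (m + 1)) : 0 < wt a b i := by
  refine Finset.prod_pos fun j _ => ?_
  have h1 := (hb j (Set.mem_univ _)).1
  have h2 := (hb j (Set.mem_univ _)).2
  rcases lt_or_ge j.castSucc i with h | h
  · rw [Fin.succAbove_of_castSucc_lt _ _ h]
    have h3 : a j.succ ≤ a i := ha.monotone (by
      rw [Fin.lt_def] at h; rw [Fin.le_def]; simp at h ⊢; omega)
    have h4 := ha h
    exact div_pos (by linarith) (by linarith)
  · rw [Fin.succAbove_of_le_castSucc _ _ h]
    have h3 : a i ≤ a j.castSucc := ha.monotone h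
    exact div_pos_of_neg_of_neg (by linarith) (by linarith)

lemma prod_erase_succAbove {m : ℕ} {R : Type*} [CommMonoid R] (i : Fin (m + 1))
    (f : Fin (m + 1) → R) : ∏ j ∈ univ.erase i, f j = ∏ j : Fin m, f (i.succAbove j) := by
  have : (univ.erase i : Finset (Fin (m + 1))) = univ.image i.succAbove := by
    ext j
    simp only [mem_erase, mem_univ, and_true, mem_image, true_and]
    exact (Fin.exists_succAbove_eq_iff).symm
  rw [this, Finset.prod_image (fun _ _ _ _ h => Fin.succAbove_right_injective h)]

open Polynomial in
lemma lagrange_wt {m : ℕ} {a : Fin (m + 1) → ℝ} (ha : Function.Injective a) (b : Fin m → ℝ) :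
    ∑ i, C (wt a b i) * ∏ j ∈ univ.erase i, (X - C (a j)) = ∏ j, (X - C (b j)) := by
  have hd : (∏ j, (X - C (b j))).degree < ((univ : Finset (Fin (m + 1))).card : WithBot ℕ) := by
    rw [degree_prod]; simp
    exact_mod_cast Nat.lt_succ_self m
  have := Lagrange.eq_interpolate (s := univ) (v := a) ha.injOn hd
  rw [this, Lagrange.interpolate_apply]
  refine Finset.sum_congr rfl fun i _ => ?_
  rw [Lagrange.basis]
  simp only [Lagrange.basisDivisor]
  rw [Finset.prod_mul_distrib, ← map_prod C, ← mul_assoc, ← C_mul, eval_prod]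
  congr 2
  simp only [eval_sub, eval_X, eval_C]
  rw [prod_erase_succAbove, wt, Finset.prod_div_distrib, Finset.prod_inv_distrib, div_eq_mul_inv]

open Polynomial in
lemma sum_wt {m : ℕ} {a : Fin (m + 1) → ℝ} (ha : Function.Injective a) (b : Fin m → ℝ) :
    ∑ i, wt a b i = 1 := by
  have h := congrArg (fun p => p.coeff m) (lagrange_wt ha b)
  have h1 : (∏ j, (X - C (b j))).coeff m = 1 := by
    have hm : (∏ j, (X - C (b j))).Monic := monic_prod_of_monic _ _ fun j _ => monic_X_sub_C _
    have hd : (∏ j, (X - C (b j))).natDegree = m := by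
      rw [natDegree_prod_of_monic _ _ fun j _ => monic_X_sub_C _]; simp
    have := hm.coeff_natDegree
    rwa [hd] at this
  have h2 : ∀ i, (∏ j ∈ univ.erase i, (X - C (a j))).coeff m = 1 := by
    intro i
    have hm : (∏ j ∈ univ.erase i, (X - C (a j))).Monic :=
      monic_prod_of_monic _ _ fun j _ => monic_X_sub_C _
    have hd : (∏ j ∈ univ.erase i, (X - C (a j))).natDegree = m := by
      rw [natDegree_prod_of_monic _ _ fun j _ => monic_X_sub_C _]; simp
    have := hm.coeff_natDegree
    rwa [hd] at this
  simp only [finsetSum_coeff, coeff_C_mul, h1, h2, mul_one] at h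
  exact h

open Polynomial in
lemma wt_injOn {m : ℕ} {a : Fin (m + 1) → ℝ} (ha : StrictMono a) : Set.InjOn (wt a) (box a) := by
  intro b hb b' hb' h
  have h1 := lagrange_wt ha.injective b
  rw [h, lagrange_wt ha.injective b'] at h1
  refine (StrictMono.range_inj (box_strictMono ha hb) (box_strictMono ha hb')).1 ?_
  have key : ∀ (c : Fin m → ℝ) x, x ∈ Set.range c ↔ (∏ j, (X - C (c j))).eval x = 0 := by
    intro c x
    rw [eval_prod, Finset.prod_eq_zero_iff]
    simp only [eval_sub, eval_X, eval_C, sub_eq_zero, mem_univ, true_and, Set.mem_range, eq_comm]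
  ext x
  rw [key, key, h1]

/-- The parametrization of the positive orthant. -/
def Tm {m : ℕ} (a : Fin (m + 1) → ℝ) (x : Fin (m + 1) → ℝ) (i : Fin (m + 1)) : ℝ :=
  x 0 * wt a (fun j => x j.succ) i

/-- The domain of the parametrization. -/
def Sm {m : ℕ} (a : Fin (m + 1) → ℝ) : Set (Fin (m + 1) → ℝ) :=
  {x | 0 < x 0 ∧ (fun j : Fin m => x j.succ) ∈ box a}

lemma sum_Tm {m : ℕ} {a : Fin (m + 1) → ℝ} (ha : Function.Injective a) (x : Fin (m + 1) → ℝ) :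
    ∑ i, Tm a x i = x 0 := by
  simp only [Tm, ← Finset.mul_sum, sum_wt ha, mul_one]

lemma Tm_injOn {m : ℕ} {a : Fin (m + 1) → ℝ} (ha : StrictMono a) : Set.InjOn (Tm a) (Sm a) := by
  intro x hx y hy h
  have h0 : x 0 = y 0 := by
    rw [← sum_Tm ha.injective x, ← sum_Tm ha.injective y, h]
  have h1 : (fun j : Fin m => x j.succ) = (fun j : Fin m => y j.succ) := by
    refine wt_injOn ha hx.2 hy.2 ?_
    ext i
    have := congrFun h i
    simp only [Tm, h0] at this
    exact mul_left_cancel₀ hy.1.ne' this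
  ext i
  refine Fin.cases h0 (fun j => congrFun h1 j) i

lemma continuous_wt {m : ℕ} (a : Fin (m + 1) → ℝ) : Continuous (wt a) := by
  unfold wt; fun_prop

/-- The Jacobian matrix. -/
def Jm {m : ℕ} (a x : Fin (m + 1) → ℝ) : Matrix (Fin (m + 1)) (Fin (m + 1)) ℝ :=
  Matrix.of fun i p => Fin.cases (wt a (fun j => x j.succ) i)
    (fun l => (∏ j : Fin m, (a i - a (i.succAbove j)))⁻¹ *
      (- x 0 * ∏ j ∈ univ.erase l, (a i - x j.succ))) p

lemma Tm_hasFDerivAt {m : ℕ} (a x : Fin (m + 1) → ℝ) :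
    HasFDerivAt (Tm a) (LinearMap.toContinuousLinearMap (Matrix.toLin' (Jm a x))) x := by
  rw [hasFDerivAt_pi']
  intro i
  have hw : ∀ x : Fin (m + 1) → ℝ, Tm a x i = (∏ j : Fin m, (a i - a (i.succAbove j)))⁻¹ *
      (x 0 * ∏ j : Fin m, (a i - x j.succ)) := by
    intro x; rw [Tm, wt, Finset.prod_div_distrib, div_eq_inv_mul]; ring
  have hf : (fun x => Tm a x i) = _ := funext hw
  rw [hf]
  have h0 : HasFDerivAt (fun x : Fin (m + 1) → ℝ => x 0) (ContinuousLinearMap.proj 0 : (Fin (m + 1) → ℝ) →L[ℝ] ℝ) x :=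
    hasFDerivAt_apply (𝕜 := ℝ) 0 x
  have h1 : HasFDerivAt (fun x : Fin (m + 1) → ℝ => ∏ j : Fin m, (a i - x j.succ))
      (∑ j : Fin m, (∏ l ∈ univ.erase j, (a i - x l.succ)) •
        (-(ContinuousLinearMap.proj j.succ : (Fin (m + 1) → ℝ) →L[ℝ] ℝ))) x := by
    refine HasFDerivAt.finsetProd fun j _ => ?_
    exact (hasFDerivAt_apply (𝕜 := ℝ) j.succ x).const_sub (a i)
  refine ((h0.mul h1).const_mul _).congr_fderiv ?_
  ext v
  simp only [ContinuousLinearMap.smul_apply, ContinuousLinearMap.add_apply,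
    ContinuousLinearMap.sum_apply, ContinuousLinearMap.neg_apply, ContinuousLinearMap.proj_apply,
    ContinuousLinearMap.comp_apply, LinearMap.coe_toContinuousLinearMap', Matrix.toLin'_apply,
    Matrix.mulVec, dotProduct, smul_eq_mul]
  rw [Fin.sum_univ_succ]
  simp only [Jm, Matrix.of_apply, Fin.cases_zero, Fin.cases_succ, wt,
    mul_add, Finset.mul_sum, div_eq_inv_mul]
  rw [add_comm]
  congr 1
  · rw [Finset.prod_mul_distrib, Finset.prod_inv_distrib]; ring
  · refine Finset.sum_congr rfl fun j _ => ?_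
    ring

end RMT

namespace RMT

lemma vdm_pos {m : ℕ} {v : Fin m → ℝ} (hv : StrictMono v) : 0 < (vandermonde v).det := by
  rw [det_vandermonde]
  refine Finset.prod_pos fun i _ => Finset.prod_pos fun j hj => ?_
  rw [Finset.mem_Ioi] at hj
  linarith [hv hj]

lemma prod_off_diag_abs {m : ℕ} (v : Fin m → ℝ) :
    ∏ l, ∏ j ∈ univ.erase l, |v l - v j| = |(vandermonde v).det| ^ 2 := by
  have h := Finset.prod_prod_Ioi_mul_eq_prod_prod_off_diag (fun i j : Fin m => |v j - v i|)
  have e : ∀ l : Fin m, ({l} : Finset (Fin m))ᶜ = univ.erase l := by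
    intro l; ext j; simp
  simp only [e] at h
  rw [← h, det_vandermonde, Finset.abs_prod, ← Finset.prod_pow]
  refine Finset.prod_congr rfl fun i _ => ?_
  rw [Finset.abs_prod, ← Finset.prod_pow]
  refine Finset.prod_congr rfl fun j _ => ?_
  rw [abs_sub_comm (v i) (v j)]; ring

open Polynomial in
lemma eval_fin {m : ℕ} (p : ℝ[X]) (hp : p.natDegree < m + 1) (x : ℝ) :
    p.eval x = ∑ q : Fin (m + 1), x ^ (q : ℕ) * p.coeff q := by
  rw [eval_eq_sum_range' hp, Finset.sum_range (fun i => p.coeff i * x ^ i)]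
  exact Finset.sum_congr rfl fun q _ => mul_comm _ _

open Polynomial in
lemma abs_det_Jm {m : ℕ} {a : Fin (m + 1) → ℝ} (ha : StrictMono a) {x : Fin (m + 1) → ℝ}
    (hx : x ∈ Sm a) :
    |(Jm a x).det| = x 0 ^ m *
      ((vandermonde (fun j : Fin m => x j.succ)).det / (vandermonde a).det) := by
  set b : Fin m → ℝ := fun j => x j.succ with hb
  have hbm : StrictMono b := box_strictMono ha hx.2
  set P : ℝ[X] := ∏ j, (X - C (b j)) with hP
  set Q : Fin m → ℝ[X] := fun l => C (-x 0) * ∏ j ∈ univ.erase l, (X - C (b j)) with hQ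
  have hPm : P.Monic := monic_prod_of_monic _ _ fun j _ => monic_X_sub_C _
  have hPd : P.natDegree = m := by
    rw [hP, natDegree_prod_of_monic _ _ fun j _ => monic_X_sub_C _]; simp
  have hQd : ∀ l, (Q l).natDegree < m := by
    intro l
    refine lt_of_le_of_lt (natDegree_C_mul_le _ _) ?_
    rw [natDegree_prod_of_monic _ _ fun j _ => monic_X_sub_C _]
    simp only [natDegree_X_sub_C, Finset.sum_const, smul_eq_mul, mul_one, Finset.mem_univ,
      Finset.card_erase_of_mem, Finset.card_univ, Fintype.card_fin]
    have := l.2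
    omega
  set F : Fin (m + 1) → ℝ[X] := fun q => Fin.cases P Q q with hF
  have hFd : ∀ q, (F q).natDegree < m + 1 := by
    intro q
    refine Fin.cases ?_ (fun l => ?_) q
    · simp only [hF, Fin.cases_zero]; omega
    · simp only [hF, Fin.cases_succ]; exact (hQd l).trans (Nat.lt_succ_self m)
  set Cm : Matrix (Fin (m + 1)) (Fin (m + 1)) ℝ := Matrix.of fun p q => (F q).coeff p with hC
  set R : Matrix (Fin (m + 1)) (Fin (m + 1)) ℝ :=
    Matrix.of fun i p => Fin.cases (if p = Fin.last m then (1 : ℝ) else 0)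
      (fun l => b l ^ (p : ℕ)) i with hR
  have hJ : Jm a x = Matrix.diagonal (fun i => (∏ j : Fin m, (a i - a (i.succAbove j)))⁻¹) *
      (vandermonde a * Cm) := by
    ext i q
    rw [Matrix.diagonal_mul, Matrix.mul_apply]
    have : ∑ p, vandermonde a i p * Cm p q = (F q).eval (a i) := by
      rw [eval_fin _ (hFd q)]; rfl
    rw [this]
    refine Fin.cases ?_ (fun l => ?_) q
    · simp only [Jm, Matrix.of_apply, Fin.cases_zero, hF, hP, eval_prod, eval_sub, eval_X, eval_C,
        wt, Finset.prod_div_distrib]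
      rw [div_eq_inv_mul]
    · simp only [Jm, Matrix.of_apply, Fin.cases_succ, hF, hQ, eval_mul, eval_prod, eval_sub,
        eval_X, eval_C]
      rfl
  have hRC : R * Cm = Matrix.diagonal (fun i => Fin.cases (1 : ℝ)
      (fun l => -x 0 * ∏ j ∈ univ.erase l, (b l - b j)) i) := by
    ext i q
    rw [Matrix.mul_apply]
    refine Fin.cases ?_ (fun l => ?_) i
    · have : ∑ p, R 0 p * Cm p q = (F q).coeff m := by
        simp [hR, hC]
      rw [this]
      refine Fin.cases ?_ (fun l => ?_) q
      · have := hPm.coeff_natDegree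
        rw [hPd] at this
        simpa [hF] using this
      · rw [Matrix.diagonal_apply_ne _ (Fin.succ_ne_zero l).symm]
        exact coeff_eq_zero_of_natDegree_lt (hQd l)
    · have : ∑ p, R l.succ p * Cm p q = (F q).eval (b l) := by
        rw [eval_fin _ (hFd q)]; rfl
      rw [this]
      refine Fin.cases ?_ (fun k => ?_) q
      · rw [Matrix.diagonal_apply_ne _ (Fin.succ_ne_zero l)]
        simp only [hF, Fin.cases_zero, hP, eval_prod, eval_sub, eval_X, eval_C]
        exact Finset.prod_eq_zero (Finset.mem_univ l) (sub_self _)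
      · by_cases hkl : l = k
        · subst hkl
          simp [hF, hQ, eval_prod]
        · rw [Matrix.diagonal_apply_ne _ (fun h => hkl (Fin.succ_injective _ h))]
          simp only [hF, Fin.cases_succ, hQ, eval_mul, eval_prod, eval_sub, eval_X, eval_C]
          rw [Finset.prod_eq_zero (Finset.mem_erase.2 ⟨hkl, Finset.mem_univ l⟩) (sub_self _),
            mul_zero]
  have hRd : |R.det| = (vandermonde b).det := by
    rw [Matrix.det_succ_row_zero, Finset.sum_eq_single (Fin.last m)]
    · have : R.submatrix Fin.succ (Fin.last m).succAbove = vandermonde b := by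
        ext i j
        simp [hR, vandermonde_apply]
      rw [this]
      simp [hR, abs_mul, abs_of_pos (vdm_pos hbm)]
    · intro j _ hj
      simp [hR, hj]
    · simp
  have hx0 : 0 < x 0 := hx.1
  have hprod : |(R * Cm).det| = x 0 ^ m * (vandermonde b).det ^ 2 := by
    rw [hRC, Matrix.det_diagonal, Fin.prod_univ_succ]
    simp only [Fin.cases_zero, Fin.cases_succ, one_mul]
    rw [Finset.abs_prod]
    simp only [abs_mul, Finset.abs_prod, abs_neg]
    rw [Finset.prod_mul_distrib, prod_off_diag_abs, sq_abs]
    simp [abs_of_pos hx0]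
  rw [Matrix.det_mul, abs_mul, hRd] at hprod
  have hVb := vdm_pos hbm
  have hVa := vdm_pos ha
  have hCd : |Cm.det| = x 0 ^ m * (vandermonde b).det := by
    have : (vandermonde b).det * |Cm.det| = (vandermonde b).det * (x 0 ^ m * (vandermonde b).det) := by
      rw [hprod]; ring
    exact mul_left_cancel₀ hVb.ne' this
  rw [hJ, Matrix.det_mul, Matrix.det_mul, Matrix.det_diagonal, abs_mul, abs_mul, hCd,
    Finset.abs_prod]
  have : ∏ i, |(∏ j : Fin m, (a i - a (i.succAbove j)))⁻¹| = ((vandermonde a).det ^ 2)⁻¹ := by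
    rw [← sq_abs, ← prod_off_diag_abs]
    simp only [prod_erase_succAbove, abs_inv, Finset.abs_prod, Finset.prod_inv_distrib]
  rw [this, abs_of_pos hVa]
  field_simp

end RMT

namespace RMT

lemma volume_box {m : ℕ} (a : Fin (m + 1) → ℝ) :
    (volume : Measure (Fin m → ℝ)).restrict (box a) =
      Measure.pi fun j : Fin m => volume.restrict (Set.Ioo (a j.castSucc) (a j.succ)) := by
  rw [box, volume_pi, Measure.restrict_pi_pi]

lemma integrable_prod_box {m : ℕ} {𝕜 : Type*} [RCLike 𝕜] (a : Fin (m + 1) → ℝ)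
    (f : Fin m → ℝ → 𝕜)
    (hf : ∀ j, IntegrableOn (f j) (Set.Ioo (a j.castSucc) (a j.succ))) :
    IntegrableOn (fun b => ∏ j, f j (b j)) (box a) := by
  rw [IntegrableOn, volume_box]
  exact Integrable.fintype_prod_dep hf

lemma integral_det_box {m : ℕ} {𝕜 : Type*} [RCLike 𝕜] (a : Fin (m + 1) → ℝ) (f : Fin m → ℝ → 𝕜)
    (hf : ∀ i j, IntegrableOn (f i) (Set.Ioo (a (Fin.castSucc j)) (a (Fin.succ j)))) :
    ∫ b in box a, (Matrix.of fun i j : Fin m => f i (b j)).det =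
      (Matrix.of fun i j : Fin m => ∫ u in Set.Ioo (a j.castSucc) (a j.succ), f i u).det := by
  simp only [Matrix.det_apply', Matrix.of_apply]
  rw [integral_finsetSum]
  · refine Finset.sum_congr rfl fun σ _ => ?_
    rw [integral_const_mul, volume_box, integral_fintype_prod_eq_prod (fun j u => f (σ j) u)]
  · intro σ _
    exact (integrable_prod_box a (fun j => f (σ j)) (fun j => hf (σ j) j)).const_mul _

lemma integrable_det_box {m : ℕ} {𝕜 : Type*} [RCLike 𝕜] (a : Fin (m + 1) → ℝ) (f : Fin m → ℝ → 𝕜)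
    (hf : ∀ i j, IntegrableOn (f i) (Set.Ioo (a (Fin.castSucc j)) (a (Fin.succ j)))) :
    IntegrableOn (fun b => (Matrix.of fun i j : Fin m => f i (b j)).det) (box a) := by
  simp only [Matrix.det_apply', Matrix.of_apply]
  exact integrable_finsetSum _ fun σ _ =>
    (integrable_prod_box a (fun j => f (σ j)) (fun j => hf (σ j) j)).const_mul _

lemma det_first {m : ℕ} {𝕜 : Type*} [CommRing 𝕜] (h : Fin m → Fin (m + 1) → 𝕜) :
    (Matrix.of fun i c : Fin (m + 1) => (Fin.cases (1 : 𝕜) (fun i => h i c) i : 𝕜)).det =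
      (Matrix.of fun i j : Fin m => h i j.succ - h i j.castSucc).det := by
  set A : Matrix (Fin (m + 1)) (Fin (m + 1)) 𝕜 :=
    Matrix.of fun i c : Fin (m + 1) => (Fin.cases (1 : 𝕜) (fun i => h i c) i : 𝕜) with hA
  rw [Matrix.det_eq_of_forall_col_eq_smul_add_pred (A := A)
    (B := Matrix.of fun i c => Fin.cases (A i 0) (fun j => A i j.succ - A i j.castSucc) c)
    (fun _ => 1) (fun i => rfl) (fun i j => by simp)]
  rw [Matrix.det_succ_row_zero, Finset.sum_eq_single 0]
  · simp only [hA, Matrix.of_apply, Fin.cases_zero]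
    simp only [Fin.val_zero, pow_zero, one_mul]
    congr 1
  · intro j _ hj
    obtain ⟨k, rfl⟩ := Fin.exists_succ_eq.2 hj
    simp [hA]
  · simp

lemma det_last {m : ℕ} {𝕜 : Type*} [CommRing 𝕜] (h : Fin m → Fin (m + 1) → 𝕜) :
    (Matrix.of fun i c : Fin (m + 1) =>
      (Fin.lastCases (1 : 𝕜) (fun i => h i c) i : 𝕜)).det =
      (-1) ^ m * (Matrix.of fun i j : Fin m => h i j.succ - h i j.castSucc).det := by
  set A : Matrix (Fin (m + 1)) (Fin (m + 1)) 𝕜 :=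
    Matrix.of fun i c : Fin (m + 1) => (Fin.lastCases (1 : 𝕜) (fun i => h i c) i : 𝕜) with hA
  rw [Matrix.det_eq_of_forall_col_eq_smul_add_pred (A := A)
    (B := Matrix.of fun i c => Fin.cases (A i 0) (fun j => A i j.succ - A i j.castSucc) c)
    (fun _ => 1) (fun i => rfl) (fun i j => by simp)]
  rw [Matrix.det_succ_row _ (Fin.last m), Finset.sum_eq_single 0]
  · simp only [hA, Matrix.of_apply, Fin.cases_zero]
    simp only [Fin.val_zero, Fin.val_last, Fin.lastCases_last, add_zero, mul_one]
    congr 2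
    ext i j
    simp
  · intro j _ hj
    obtain ⟨k, rfl⟩ := Fin.exists_succ_eq.2 hj
    simp [hA]
  · simp

lemma mass_box {m : ℕ} {a : Fin (m + 1) → ℝ} (ha : StrictMono a) :
    IntegrableOn (fun b => (vandermonde b).det) (box a) ∧
    ∫ b in box a, (vandermonde b).det = (vandermonde a).det / (m.factorial : ℝ) := by
  have e : ∀ b : Fin m → ℝ, (vandermonde b).det =
      (Matrix.of fun i j : Fin m => (fun (i : Fin m) (u : ℝ) => u ^ (i : ℕ)) i (b j)).det := by
    intro b
    rw [← Matrix.det_transpose]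
    rfl
  have hf : ∀ i j : Fin m, IntegrableOn ((fun (i : Fin m) (u : ℝ) => u ^ (i : ℕ)) i)
      (Set.Ioo (a (Fin.castSucc j)) (a (Fin.succ j))) := by
    intro i j
    exact ((continuous_pow _).integrableOn_Icc).mono_set Set.Ioo_subset_Icc_self
  simp only [e]
  refine ⟨integrable_det_box a _ hf, ?_⟩
  rw [integral_det_box a _ hf]
  have h1 : ∀ i j : Fin m, ∫ u in Set.Ioo (a (Fin.castSucc j)) (a (Fin.succ j)), u ^ (i : ℕ) =
      a j.succ ^ ((i : ℕ) + 1) / ((i : ℕ) + 1) - a j.castSucc ^ ((i : ℕ) + 1) / ((i : ℕ) + 1) := by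
    intro i j
    rw [← integral_Ioc_eq_integral_Ioo,
      ← intervalIntegral.integral_of_le (ha.monotone (Fin.castSucc_lt_succ).le), integral_pow]
    ring
  simp only [h1]
  rw [← det_first (fun i c => a c ^ ((i : ℕ) + 1) / (((i : ℕ) : ℝ) + 1))]
  have h2 : (Matrix.of fun i c : Fin (m + 1) =>
      (Fin.cases (1 : ℝ) (fun i => a c ^ ((i : ℕ) + 1) / (((i : ℕ) : ℝ) + 1)) i : ℝ)) =
      Matrix.diagonal (fun i => (Fin.cases (1 : ℝ) (fun i => (((i : ℕ) : ℝ) + 1)⁻¹) i : ℝ)) *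
        (vandermonde a)ᵀ := by
    ext i c
    rw [Matrix.diagonal_mul]
    refine Fin.cases ?_ (fun i => ?_) i
    · simp [vandermonde_apply]
    · simp [vandermonde_apply, div_eq_inv_mul]
  rw [h2, Matrix.det_mul, Matrix.det_transpose, Matrix.det_diagonal, Fin.prod_univ_succ]
  simp only [Fin.cases_zero, Fin.cases_succ, one_mul, Finset.prod_inv_distrib]
  rw [div_eq_inv_mul]
  congr 2
  rw [Fin.prod_univ_eq_prod_range (fun i => (i : ℝ) + 1), ← Finset.prod_range_add_one_eq_factorial]
  push_cast
  rfl

end RMT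

namespace RMT

lemma isOpen_box {m : ℕ} (a : Fin (m + 1) → ℝ) : IsOpen (box a) :=
  isOpen_set_pi Set.finite_univ fun _ _ => isOpen_Ioo

lemma isOpen_Sm {m : ℕ} (a : Fin (m + 1) → ℝ) : IsOpen (Sm a) := by
  refine IsOpen.inter (isOpen_lt continuous_const (continuous_apply 0)) ?_
  exact (isOpen_box a).preimage (by fun_prop)

/-- The density of the corner spectrum on the box. -/
def rho {m : ℕ} (a : Fin (m + 1) → ℝ) (b : Fin m → ℝ) : ℝ :=
  (m.factorial : ℝ) * ((vandermonde b).det / (vandermonde a).det)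

lemma continuous_vdm {m : ℕ} : Continuous fun b : Fin m → ℝ => (vandermonde b).det := by
  refine Continuous.matrix_det ?_
  refine continuous_pi fun i => continuous_pi fun j => ?_
  simp only [vandermonde_apply]
  fun_prop

lemma lintegral_gamma (m : ℕ) :
    ∫⁻ r in Set.Ioi (0 : ℝ), ENNReal.ofReal (r ^ m * Real.exp (-r)) =
      ENNReal.ofReal (m.factorial : ℝ) := by
  have hi : IntegrableOn (fun r : ℝ => r ^ m * Real.exp (-r)) (Set.Ioi 0) := by
    have := Real.GammaIntegral_convergent (s := (m : ℝ) + 1) (by positivity)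
    refine this.congr_fun (fun r hr => ?_) measurableSet_Ioi
    simp only [add_sub_cancel_right, Real.rpow_natCast]
    ring
  rw [← ofReal_integral_eq_lintegral_ofReal hi]
  · rw [← Real.Gamma_nat_eq_factorial, Real.Gamma_eq_integral (by positivity)]
    congr 1
    refine setIntegral_congr_fun measurableSet_Ioi fun r hr => ?_
    simp only [add_sub_cancel_right, Real.rpow_natCast]
    ring
  · refine (ae_restrict_iff' measurableSet_Ioi).2 (Filter.Eventually.of_forall fun r hr => ?_)
    have : (0 : ℝ) < r := hr
    positivity

lemma lintegral_image_Tm {m : ℕ} {a : Fin (m + 1) → ℝ} (ha : StrictMono a)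
    {φ : (Fin (m + 1) → ℝ) → ENNReal} (hφ : Measurable φ) :
    ∫⁻ t in Set.image (Tm a) (Sm a), φ (fun i => t i / ∑ j, t j) * ENNReal.ofReal (Real.exp (-∑ i, t i)) =
      ∫⁻ b in box a, ENNReal.ofReal (rho a b) * φ (wt a b) := by
  rw [lintegral_image_eq_lintegral_abs_det_fderiv_mul volume (isOpen_Sm a).measurableSet
    (fun x _ => (Tm_hasFDerivAt a x).hasFDerivWithinAt) (Tm_injOn ha)]
  have hVa := vdm_pos ha
  have hpw : ∀ x ∈ Sm a, ENNReal.ofReal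
      |(LinearMap.toContinuousLinearMap (Matrix.toLin' (Jm a x))).det| *
      (φ (fun i => Tm a x i / ∑ j, Tm a x j) * ENNReal.ofReal (Real.exp (-∑ i, Tm a x i))) =
      ENNReal.ofReal (x 0 ^ m * Real.exp (-x 0)) *
        (ENNReal.ofReal ((vandermonde (fun j : Fin m => x j.succ)).det / (vandermonde a).det) *
          φ (wt a (fun j : Fin m => x j.succ))) := by
    intro x hx
    have hx0 : 0 < x 0 := hx.1
    have e1 : (LinearMap.toContinuousLinearMap (Matrix.toLin' (Jm a x))).det = (Jm a x).det := by
      simp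
    have e2 : (fun i => Tm a x i / ∑ j, Tm a x j) = wt a (fun j : Fin m => x j.succ) := by
      ext i
      rw [sum_Tm ha.injective, Tm, mul_div_cancel_left₀ _ hx0.ne']
    have hVb := vdm_pos (box_strictMono ha hx.2)
    rw [e1, e2, sum_Tm ha.injective, abs_det_Jm ha hx, ENNReal.ofReal_mul (by positivity),
      ENNReal.ofReal_mul (by positivity)]
    ring
  rw [setLIntegral_congr_fun (isOpen_Sm a).measurableSet hpw]
  set F : ℝ → ENNReal := fun r => ENNReal.ofReal (r ^ m * Real.exp (-r)) with hF
  set G : (Fin m → ℝ) → ENNReal := fun b =>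
    ENNReal.ofReal ((vandermonde b).det / (vandermonde a).det) * φ (wt a b) with hG
  have hFm : Measurable F := by fun_prop
  have hGm : Measurable G :=
    (ENNReal.measurable_ofReal.comp (continuous_vdm.measurable.div_const _)).mul
      (hφ.comp (continuous_wt a).measurable)
  have hmp := volume_preserving_piFinSuccAbove (fun _ : Fin (m + 1) => ℝ) 0
  have hS : Sm a = (MeasurableEquiv.piFinSuccAbove (fun _ : Fin (m + 1) => ℝ) 0) ⁻¹'
      (Set.Ioi 0 ×ˢ box a) := by
    ext x
    rfl
  have h3 : ∫⁻ x in Sm a, F (x 0) * G (fun j : Fin m => x j.succ) =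
      ∫⁻ p in Set.Ioi (0 : ℝ) ×ˢ box a, F p.1 * G p.2 := by
    rw [hS]
    exact hmp.setLIntegral_comp_preimage (measurableSet_Ioi.prod (isOpen_box a).measurableSet)
      (f := fun p : ℝ × (Fin m → ℝ) => F p.1 * G p.2) (by fun_prop)
  have h4 : ∫⁻ p in Set.Ioi (0 : ℝ) ×ˢ box a, F p.1 * G p.2 =
      (∫⁻ r in Set.Ioi (0 : ℝ), F r) * ∫⁻ b in box a, G b := by
    rw [Measure.volume_eq_prod, ← Measure.prod_restrict,
      lintegral_prod_mul hFm.aemeasurable hGm.aemeasurable]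
  rw [h3, h4, lintegral_gamma, ← lintegral_const_mul _ hGm]
  refine lintegral_congr fun b => ?_
  rw [hG, rho, ENNReal.ofReal_mul (by positivity), mul_assoc]

lemma lintegral_rho {m : ℕ} {a : Fin (m + 1) → ℝ} (ha : StrictMono a) :
    ∫⁻ b in box a, ENNReal.ofReal (rho a b) = 1 := by
  obtain ⟨hi, he⟩ := mass_box ha
  have hVa := vdm_pos ha
  have hi2 : IntegrableOn (rho a) (box a) := (hi.div_const _).const_mul _
  rw [← ofReal_integral_eq_lintegral_ofReal hi2]
  · have : ∫ b in box a, rho a b = 1 := by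
      simp only [rho]
      rw [integral_const_mul, integral_div, he]
      have : (m.factorial : ℝ) ≠ 0 := by positivity
      field_simp
    rw [this, ENNReal.ofReal_one]
  · refine (ae_restrict_iff' (isOpen_box a).measurableSet).2
      (Filter.Eventually.of_forall fun b hb => ?_)
    have := vdm_pos (box_strictMono ha hb)
    simp only [rho, Pi.zero_apply]
    positivity

lemma row_law {m : ℕ} {μ : Measure (Matrix (Fin (m + 1)) (Fin (m + 1)) ℂ)}
    (hμ : IsHaarUnitary (m + 1) μ) {a : Fin (m + 1) → ℝ} (ha : StrictMono a)
    {φ : (Fin (m + 1) → ℝ) → ENNReal} (hφ : Measurable φ) :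
    ∫⁻ k, φ (fun i => ‖k (Fin.last m) i‖ ^ 2) ∂μ =
      ∫⁻ b in box a, ENNReal.ofReal (rho a b) * φ (wt a b) := by
  rw [row_lintegral hμ hφ, ← lintegral_image_Tm ha hφ]
  have hO : Measure.pi (fun _ : Fin (m + 1) => posLeb) =
      (volume : Measure (Fin (m + 1) → ℝ)).restrict (Set.univ.pi fun _ => Set.Ioi 0) := by
    rw [volume_pi, Measure.restrict_pi_pi]; rfl
  set O : Set (Fin (m + 1) → ℝ) := Set.univ.pi fun _ => Set.Ioi 0 with hOd
  have hOm : MeasurableSet O := MeasurableSet.univ_pi fun _ => measurableSet_Ioi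
  have hTm : MeasurableSet (Set.image (Tm a) (Sm a)) :=
    measurable_image_of_fderivWithin (isOpen_Sm a).measurableSet
      (fun x _ => (Tm_hasFDerivAt a x).hasFDerivWithinAt) (Tm_injOn ha)
  have hsub : Set.image (Tm a) (Sm a) ⊆ O := by
    rintro _ ⟨x, hx, rfl⟩ i _
    exact mul_pos hx.1 (wt_pos ha hx.2 i)
  have hwm : Measurable fun t : Fin (m + 1) → ℝ => ENNReal.ofReal (Real.exp (-∑ i, t i)) := by
    fun_prop
  have h1 := lintegral_exp_one (m + 1)
  rw [hO] at h1 ⊢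
  have h2 := lintegral_image_Tm ha (φ := fun _ => 1) measurable_const
  simp only [one_mul, mul_one, lintegral_rho ha] at h2
  have h3 := lintegral_inter_add_sdiff (μ := volume)
    (fun t : Fin (m + 1) → ℝ => ENNReal.ofReal (Real.exp (-∑ i, t i))) O hTm
  rw [Set.inter_eq_self_of_subset_right hsub, h1, h2] at h3
  have h4 : ∫⁻ t in O \ (Set.image (Tm a) (Sm a)), ENNReal.ofReal (Real.exp (-∑ i, t i)) = 0 := by
    have : (1 : ENNReal) + ∫⁻ t in O \ (Set.image (Tm a) (Sm a)), ENNReal.ofReal (Real.exp (-∑ i, t i)) =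
      1 + 0 := by rw [h3, add_zero]
    exact (ENNReal.add_right_inj ENNReal.one_ne_top).1 this
  have h5 : volume (O \ (Set.image (Tm a) (Sm a))) = 0 := by
    rw [lintegral_eq_zero_iff hwm] at h4
    have : ∀ᵐ t ∂((volume : Measure (Fin (m + 1) → ℝ)).restrict (O \ (Set.image (Tm a) (Sm a)))), False := by
      filter_upwards [h4] with t ht
      simp only [Pi.zero_apply, ENNReal.ofReal_eq_zero] at ht
      exact absurd ht (not_le.2 (Real.exp_pos _))
    rw [ae_iff] at this
    simpa using this
  have h6 : (Set.image (Tm a) (Sm a)) =ᵐ[volume] O := by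
    refine (hsub.eventuallyLE).antisymm ?_
    rw [ae_le_set]; exact h5
  rw [Measure.restrict_congr_set h6]

end RMT

namespace RMT

/-- The points of the box with nonzero coordinates. -/
def box0 {m : ℕ} (a : Fin (m + 1) → ℝ) : Set (Fin m → ℝ) := box a ∩ {b | ∀ j, b j ≠ 0}

lemma measurableSet_box0 {m : ℕ} (a : Fin (m + 1) → ℝ) : MeasurableSet (box0 a) := by
  refine (isOpen_box a).measurableSet.inter ?_
  have : {b : Fin m → ℝ | ∀ j, b j ≠ 0} = ⋂ j, {b | b j ≠ 0} := by ext; simp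
  rw [this]
  exact MeasurableSet.iInter fun j =>
    (measurableSet_eq_fun (measurable_pi_apply j) measurable_const).compl

lemma ae_box0 {m : ℕ} (a : Fin (m + 1) → ℝ) :
    ∀ᵐ b ∂(volume : Measure (Fin m → ℝ)).restrict (box a), b ∈ box0 a := by
  have h : ∀ᵐ b : Fin m → ℝ, ∀ j, b j ≠ 0 := by
    rw [ae_all_iff]
    intro j
    have := Measure.ae_eval_ne (μ := fun _ : Fin m => (volume : Measure ℝ)) j 0
    exact this
  filter_upwards [ae_restrict_of_ae h, ae_restrict_mem (isOpen_box a).measurableSet] with b h1 h2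
  exact ⟨h2, h1⟩

lemma haar_corner_integral {m : ℕ} {μ : Measure (Matrix (Fin (m + 1)) (Fin (m + 1)) ℂ)}
    (hμ : IsHaarUnitary (m + 1) μ) {a : Fin (m + 1) → ℝ} (ha : StrictMono a)
    (g : Matrix (Fin (m + 1)) (Fin (m + 1)) ℂ → ℂ) (H : (Fin m → ℝ) → ℂ) (hH : Measurable H)
    (hgH : ∀ k ∈ Matrix.unitaryGroup (Fin (m + 1)) ℂ, ∀ b ∈ box0 a,
      (fun i => ‖k (Fin.last m) i‖ ^ 2) = wt a b → g k = H b) :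
    ∫ k, g k ∂μ = ∫ b in box a, (rho a b : ℂ) * H b := by
  have hrow : Measurable fun k : Matrix (Fin (m + 1)) (Fin (m + 1)) ℂ =>
      (fun i => ‖k (Fin.last m) i‖ ^ 2 : Fin (m + 1) → ℝ) := by
    have : Continuous fun k : Matrix (Fin (m + 1)) (Fin (m + 1)) ℂ =>
      (fun i => ‖k (Fin.last m) i‖ ^ 2 : Fin (m + 1) → ℝ) := by fun_prop
    exact this.measurable
  have hemb : MeasurableEmbedding (Set.domRestrict (box0 a) (wt a)) :=
    (continuous_wt a).continuousOn.measurableEmbedding (measurableSet_box0 a)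
      ((wt_injOn ha).mono Set.inter_subset_left)
  obtain ⟨ψ, hψm, hψ⟩ := hemb.exists_measurable_extend
    (g := fun b : box0 a => H b) (hH.comp measurable_subtype_coe) (fun _ => ⟨0⟩)
  have himg : MeasurableSet (Set.image (wt a) (box0 a)) := by
    have := hemb.measurableSet_range
    rwa [Set.range_domRestrict] at this
  have hψ' : ∀ b ∈ box0 a, ψ (wt a b) = H b := fun b hb => congrFun hψ ⟨b, hb⟩
  have hdm : Measurable fun b => ENNReal.ofReal (rho a b) := by
    have : Continuous (rho a) := (continuous_vdm.div_const _).const_mul _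
    exact ENNReal.measurable_ofReal.comp this.measurable
  -- almost every row is in the image
  have hae : ∀ᵐ k ∂μ, (fun i => ‖k (Fin.last m) i‖ ^ 2 : Fin (m + 1) → ℝ) ∈ Set.image (wt a) (box0 a) := by
    have h1 := row_law hμ ha (φ := Set.indicator (Set.image (wt a) (box0 a))ᶜ 1)
      (measurable_one.indicator himg.compl)
    have h2 : ∫⁻ b in box a, ENNReal.ofReal (rho a b) *
        Set.indicator (Set.image (wt a) (box0 a))ᶜ 1 (wt a b) = 0 := by
      refine (lintegral_congr_ae (g := fun _ => 0) ?_).trans lintegral_zero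
      filter_upwards [ae_box0 a] with b hb
      have : wt a b ∈ Set.image (wt a) (box0 a) := ⟨b, hb, rfl⟩
      simp [this]
    have h3 := (lintegral_eq_zero_iff ((measurable_one.indicator himg.compl).comp hrow)).1
      (h1.trans h2)
    filter_upwards [h3] with k hk
    by_contra hc
    have : (fun i => ‖k (Fin.last m) i‖ ^ 2 : Fin (m + 1) → ℝ) ∈ (Set.image (wt a) (box0 a))ᶜ := hc
    simp only [Function.comp_apply, Set.indicator_of_mem this] at hk
    simp at hk
  have hU := haar_ae hμ
  have h1 : ∫ k, g k ∂μ = ∫ k, ψ (fun i => ‖k (Fin.last m) i‖ ^ 2) ∂μ := by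
    refine integral_congr_ae ?_
    filter_upwards [hae, hU] with k hk hkU
    obtain ⟨b, hb, hbk⟩ := hk
    rw [hgH k hkU b hb hbk.symm, ← hbk, hψ' b hb]
  have h2 : μ.map (fun k => (fun i => ‖k (Fin.last m) i‖ ^ 2 : Fin (m + 1) → ℝ)) =
      (((volume : Measure (Fin m → ℝ)).restrict (box a)).withDensity
        (fun b => ENNReal.ofReal (rho a b))).map (wt a) := by
    ext s hs
    rw [Measure.map_apply hrow hs, Measure.map_apply (continuous_wt a).measurable hs,
      withDensity_apply _ ((continuous_wt a).measurable hs), ← lintegral_indicator_one (hrow hs),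
      ← lintegral_indicator ((continuous_wt a).measurable hs)]
    refine (row_law hμ ha (φ := Set.indicator s 1) (measurable_one.indicator hs)).trans ?_
    refine lintegral_congr fun b => ?_
    by_cases hb : wt a b ∈ s
    · rw [Set.indicator_of_mem hb, Set.indicator_of_mem (by exact hb)]; simp
    · rw [Set.indicator_of_notMem hb, Set.indicator_of_notMem (by exact hb)]; simp
  rw [h1, ← integral_map hrow.aemeasurable hψm.aestronglyMeasurable, h2,
    integral_map (continuous_wt a).measurable.aemeasurable hψm.aestronglyMeasurable,
    integral_withDensity_eq_integral_toReal_smul hdm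
      (Filter.Eventually.of_forall fun b => ENNReal.ofReal_lt_top)]
  refine integral_congr_ae ?_
  filter_upwards [ae_box0 a] with b hb
  have hVa := vdm_pos ha
  have hVb := vdm_pos (box_strictMono ha hb.1)
  have : 0 ≤ rho a b := by unfold rho; positivity
  rw [hψ' b hb, ENNReal.toReal_ofReal this, Complex.real_smul]

end RMT

namespace RMT

lemma gpow_pos (L : ℤ) (s : ℂ) {u : ℝ} (hu : 0 < u) : gpow L s u = (u : ℂ) ^ s := by
  simp [gpow, hu.ne', Real.sign_of_pos hu, abs_of_pos hu]

lemma gpow_neg (L : ℤ) (s : ℂ) {u : ℝ} (hu : u < 0) :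
    gpow L s u = (-1 : ℂ) ^ L * ((-u : ℝ) : ℂ) ^ s := by
  simp [gpow, hu.ne, Real.sign_of_neg hu, abs_of_neg hu]

lemma gpow_hasDerivAt (L : ℤ) {s : ℂ} (hs : 0 ≤ s.re) {u : ℝ} (hu : u ≠ 0) :
    HasDerivAt (fun y => gpow (L + 1) (s + 1) y / (s + 1)) (gpow L s u) u := by
  have hs1 : s ≠ -1 := by
    rintro rfl
    norm_num at hs
  rcases lt_or_gt_of_ne hu with h | h
  · have h1 := hasDerivAt_ofReal_cpow_const' (x := -u) (by linarith) hs1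
    have h2 := (h1.scomp u (hasDerivAt_neg u)).const_mul ((-1 : ℂ) ^ (L + 1))
    rw [gpow_neg _ _ h]
    refine (h2.congr_of_eventuallyEq ?_).congr_deriv ?_
    · filter_upwards [Iio_mem_nhds h] with y hy
      rw [gpow_neg _ _ hy]
      simp [mul_div_assoc]
    · rw [zpow_add₀ (by norm_num)]
      simp
  · have h1 := hasDerivAt_ofReal_cpow_const' (x := u) hu hs1
    rw [gpow_pos _ _ h]
    refine h1.congr_of_eventuallyEq ?_
    filter_upwards [Ioi_mem_nhds h] with y hy
    rw [gpow_pos _ _ hy]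

lemma gpow_continuous (L : ℤ) {s : ℂ} (hs : 0 ≤ s.re) :
    Continuous (fun y => gpow (L + 1) (s + 1) y / (s + 1)) := by
  rw [continuous_iff_continuousAt]
  intro u
  by_cases hu : u = 0
  · subst hu
    have h0 : ContinuousAt (gpow (L + 1) (s + 1)) 0 := by
      rw [ContinuousAt]
      have : gpow (L + 1) (s + 1) 0 = 0 := by simp [gpow]
      rw [this]
      have ht : Tendsto (fun y : ℝ => |y| ^ (s + 1).re) (nhds 0) (nhds 0) := by
        have : ContinuousAt (fun y : ℝ => |y| ^ (s + 1).re) 0 :=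
          (continuous_abs.continuousAt).rpow_const (Or.inr (by simp; linarith))
        have h := this.tendsto
        rwa [abs_zero, Real.zero_rpow (by simp; linarith)] at h
      refine squeeze_zero_norm (fun y => ?_) ht
      by_cases hy : y = 0
      · subst hy
        rw [this, norm_zero]; positivity
      · rw [norm_gpow hy]
    exact h0.div_const _
  · exact (gpow_hasDerivAt L hs hu).continuousAt

lemma gpow_integrable (L : ℤ) {s : ℂ} (hs : 0 ≤ s.re) (c d : ℝ) :
    IntegrableOn (gpow L s) (Set.Icc c d) := by
  refine Measure.integrableOn_of_bounded (M := (max |c| |d|) ^ s.re)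
    isCompact_Icc.measure_lt_top.ne (measurable_gpow L s).aestronglyMeasurable ?_
  refine (ae_restrict_iff' measurableSet_Icc).2 (Filter.Eventually.of_forall fun u hu => ?_)
  exact norm_gpow_le hs (abs_le_max_abs_abs hu.1 hu.2)

lemma gpow_integral (L : ℤ) {s : ℂ} (hs : 0 ≤ s.re) {c d : ℝ} (hcd : c ≤ d) :
    ∫ u in Set.Ioo c d, gpow L s u =
      gpow (L + 1) (s + 1) d / (s + 1) - gpow (L + 1) (s + 1) c / (s + 1) := by
  rw [← integral_Ioc_eq_integral_Ioo, ← intervalIntegral.integral_of_le hcd]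
  refine integral_eq_of_hasDerivAt_off_countable (f := fun y => gpow (L + 1) (s + 1) y / (s + 1))
    (gpow L s) (Set.countable_singleton 0)
    (gpow_continuous L hs).continuousOn (fun x hx => gpow_hasDerivAt L hs ?_) ?_
  · exact hx.2
  · rw [intervalIntegrable_iff_integrableOn_Icc_of_le hcd]
    exact gpow_integrable L hs c d

end RMT

namespace RMT

lemma VdmC_eq {n : ℕ} (f : ℕ → ℂ) : VdmC n f = (vandermonde fun i : Fin n => f i).det := by
  rw [det_vandermonde, VdmC, Finset.prod_range (fun c => ∏ d ∈ Finset.range c, (f c - f d))]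
  rw [Finset.prod_comm' (s' := fun y : Fin n => Finset.Iio y) (t' := univ) (by simp)]
  refine Finset.prod_congr rfl fun c _ => ?_
  have : Finset.range (c : ℕ) = (Finset.Iio c).map Fin.valEmbedding := by
    rw [Fin.map_valEmbedding_Iio]; ext; simp
  rw [this, Finset.prod_map]
  rfl

lemma re_gap {n : ℕ} {s : ℕ → ℂ} (hs : ∀ j < n, 1 ≤ (s j - sNext n s j).re) (i : ℕ) :
    ∀ j, i < j → j < n → 1 ≤ (s i - s j).re := by
  intro j
  induction j with
  | zero => intro h; omega
  | succ j ih =>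
    intro hij hj
    have h1 := hs j (by omega)
    rw [sNext, if_pos hj] at h1
    rcases Nat.lt_or_ge i j with h | h
    · have h2 := ih h (by omega)
      simp only [Complex.sub_re] at h1 h2 ⊢
      linarith
    · obtain rfl : i = j := by omega
      exact h1

lemma VdmC_ne {n : ℕ} {s : ℕ → ℂ} (hs : ∀ j < n, 1 ≤ (s j - sNext n s j).re) : VdmC n s ≠ 0 := by
  refine Finset.prod_ne_zero_iff.2 fun c hc => Finset.prod_ne_zero_iff.2 fun d hd h => ?_
  rw [Finset.mem_range] at hc hd
  have := re_gap hs d c hd hc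
  rw [sub_eq_zero] at h
  rw [h] at this
  norm_num at this

lemma vdm_ofReal {m : ℕ} (b : Fin m → ℝ) :
    (vandermonde fun i => (b i : ℂ)).det = (((vandermonde b).det : ℝ) : ℂ) := by
  simp only [det_vandermonde]
  push_cast
  rfl

lemma corner_charpoly {m : ℕ} {a : Fin (m + 1) → ℝ} (ha : Function.Injective a)
    {k : Matrix (Fin (m + 1)) (Fin (m + 1)) ℂ}
    (hk : k ∈ Matrix.unitaryGroup (Fin (m + 1)) ℂ) {b : Fin m → ℝ}
    (h : (fun i => ‖k (Fin.last m) i‖ ^ 2) = wt a b) :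
    (corner (k * diagonal (fun i => (a i : ℂ)) * kᴴ)).charpoly =
      (diagonal fun i => (b i : ℂ)).charpoly := by
  refine Polynomial.funext fun z => ?_
  rw [corner_charpoly_eval hk, charpoly_diagonal]
  have h1 := congrArg (fun p => (p.map Complex.ofRealHom).eval z) (lagrange_wt ha b)
  simp only [Polynomial.map_sum, Polynomial.map_mul, Polynomial.map_prod, Polynomial.map_sub,
    Polynomial.map_X, Polynomial.map_C, Polynomial.eval_finsetSum, Polynomial.eval_mul,
    Polynomial.eval_prod, Polynomial.eval_sub, Polynomial.eval_X, Polynomial.eval_C,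
    Complex.ofRealHom_eq_coe] at h1
  simp only [Polynomial.eval_prod, Polynomial.eval_sub, Polynomial.eval_X, Polynomial.eval_C]
  rw [← h1]
  refine Finset.sum_congr rfl fun i _ => ?_
  rw [← congrFun h i]

/-- The right-hand side of the formula. -/
def rhs (n : ℕ) (L : ℕ → ℤ) (s : ℕ → ℂ) (a : Fin n → ℝ) : ℂ :=
  (∏ j ∈ Finset.range n, (Nat.factorial j : ℂ)) *
    (Matrix.of fun b c : Fin n => gpow (L b) (s b) (a c)).det /
    ((((vandermonde a).det : ℝ) : ℂ) * VdmC n s)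

lemma measurable_rhs (n : ℕ) (L : ℕ → ℤ) (s : ℕ → ℂ) : Measurable (rhs n L s) := by
  have h1 : Measurable fun a : Fin n → ℝ =>
      (Matrix.of fun b c : Fin n => gpow (L b) (s b) (a c)).det := by
    simp only [Matrix.det_apply', Matrix.of_apply]
    refine Finset.measurable_fun_sum _ fun σ _ => ?_
    refine Measurable.const_mul ?_ _
    refine Finset.measurable_fun_prod _ fun i _ => ?_
    exact (measurable_gpow _ _).comp (measurable_pi_apply i)
  have h2 : Measurable fun a : Fin n → ℝ => (((vandermonde a).det : ℝ) : ℂ) :=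
    Complex.measurable_ofReal.comp continuous_vdm.measurable
  unfold rhs
  exact (h1.const_mul _).div (h2.mul_const _)

lemma sorted_formula (n : ℕ) : ∀ (a : Fin n → ℝ), StrictMono a → (∀ i, a i ≠ 0) →
    ∀ (L : ℕ → ℤ) (s : ℕ → ℂ), (∀ j < n, 1 ≤ (s j - sNext n s j).re) →
    ∀ μ : Measure (Matrix (Fin n) (Fin n) ℂ), IsHaarUnitary n μ →
    Nsph n n μ s L (diagonal fun i => (a i : ℂ)) = rhs n L s a := by
  induction n with
  | zero =>
    intro a _ _ L s _ μ hμ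
    have := hμ.1
    simp [Nsph, sphProd, rhs, VdmC]
  | succ m ih =>
    intro a ha ha0 L s hs μ hμ
    obtain ⟨ν, hν⟩ := exists_haar m
    set s' : ℕ → ℂ := fun j => s j - s m - 1 with hs'
    set L' : ℕ → ℤ := fun j => L j - L m - 1 with hL'
    have hss := step_shift hs
    rw [Nsph_rec hμ hν s L hs]
    have hre : ∀ i : Fin m, 1 ≤ (s i - s m).re := fun i =>
      re_gap hs i m i.2 (Nat.lt_succ_self m)
    have hne : ∀ i : Fin m, s i - s m ≠ 0 := by
      intro i h0
      have := hre i
      rw [h0] at this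
      norm_num at this
    have hre' : ∀ i : Fin m, 0 ≤ (s' i).re := by
      intro i
      have := hre i
      simp only [hs', Complex.sub_re, Complex.one_re] at this ⊢
      linarith
    have hVa : ((((vandermonde a).det : ℝ) : ℂ)) ≠ 0 := by
      exact_mod_cast (vdm_pos ha).ne'
    have hVs : VdmC m s' = VdmC m s := by
      unfold VdmC
      refine Finset.prod_congr rfl fun c _ => Finset.prod_congr rfl fun d _ => ?_
      simp only [hs']; ring
    have hVs0 : VdmC m s ≠ 0 := hVs ▸ VdmC_ne hss
    -- the integral over the unitary group
    have hintegral : ∫ k, Nsph m m ν s' L' (corner (k * diagonal (fun i => (a i : ℂ)) * kᴴ)) ∂μ =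
        ∫ b in box a, (rho a b : ℂ) * rhs m L' s' b := by
      refine haar_corner_integral hμ ha _ _ (measurable_rhs _ _ _) ?_
      intro k hk b hb hkb
      rw [← ih b (box_strictMono ha hb.1) hb.2 L' s' hss ν hν]
      refine Nsph_congr hν s' L' ?_ ?_ (corner_charpoly ha.injective hk hkb)
      · have h1 : (diagonal fun i => (a i : ℂ)).IsHermitian :=
          isHermitian_diagonal_of_self_adjoint _ (by ext i; simp)
        exact (isHermitian_mul_mul_conjTranspose k h1).submatrix _
      · exact isHermitian_diagonal_of_self_adjoint _ (by ext i; simp)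
    have hcongr : ∫ b in box a, (rho a b : ℂ) * rhs m L' s' b =
        ∫ b in box a, ((m.factorial : ℂ) * (∏ j ∈ Finset.range m, (Nat.factorial j : ℂ)) /
          ((((vandermonde a).det : ℝ) : ℂ) * VdmC m s)) *
          (Matrix.of fun i j : Fin m => gpow (L' i) (s' i) (b j)).det := by
      refine setIntegral_congr_fun (isOpen_box a).measurableSet fun b hb => ?_
      have hVb : ((((vandermonde b).det : ℝ) : ℂ)) ≠ 0 := by
        exact_mod_cast (vdm_pos (box_strictMono ha hb)).ne'
      simp only [rho, rhs, hVs]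
      push_cast
      field_simp
    have hdet : ∫ b in box a, (Matrix.of fun i j : Fin m => gpow (L' i) (s' i) (b j)).det =
        (-1) ^ m * (Matrix.of fun i c : Fin (m + 1) => (Fin.lastCases (1 : ℂ) (fun i : Fin m =>
          gpow (L i - L m) (s i - s m) (a c) / (s i - s m)) i : ℂ)).det := by
      rw [integral_det_box a (fun i : Fin m => gpow (L' i) (s' i)) (fun i j =>
        (gpow_integrable _ (hre' i) _ _).mono_set Set.Ioo_subset_Icc_self), det_last, ← mul_assoc,
        ← mul_pow]
      simp only [neg_mul_neg, mul_one, one_pow, one_mul]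
      congr 1
      ext i j
      simp only [Matrix.of_apply]
      rw [gpow_integral _ (hre' i) (ha.monotone (Fin.castSucc_lt_succ).le)]
      simp only [hs', hL', sub_add_cancel]
    have hG : (Matrix.of fun b c : Fin (m + 1) => gpow (L b) (s b) (a c)) =
        diagonal (fun i => (Fin.lastCases (1 : ℂ) (fun i : Fin m => s i - s m) i : ℂ)) *
        (Matrix.of fun i c : Fin (m + 1) => (Fin.lastCases (1 : ℂ) (fun i : Fin m =>
          gpow (L i - L m) (s i - s m) (a c) / (s i - s m)) i : ℂ)) *
        diagonal (fun c => gpow (L m) (s m) (a c)) := by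
      ext i c
      rw [mul_diagonal, diagonal_mul]
      refine Fin.lastCases ?_ (fun i => ?_) i
      · simp
      · simp only [Matrix.of_apply, Fin.lastCases_castSucc, Fin.val_castSucc]
        rw [mul_div_cancel₀ _ (hne i), ← gpow_add (ha0 c), sub_add_cancel, sub_add_cancel]
    have hdx : (det (diagonal fun i => (a i : ℂ))).re = ∏ c, a c := by
      rw [det_diagonal, ← Complex.ofReal_prod, Complex.ofReal_re]
    have hVsucc : VdmC (m + 1) s = VdmC m s * ((-1) ^ m * ∏ i : Fin m, (s i - s m)) := by
      rw [VdmC, Finset.prod_range_succ, Finset.prod_range (fun d => s m - s d)]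
      congr 1
      have : ((-1 : ℂ)) ^ m = ∏ i : Fin m, (-1 : ℂ) := by simp
      rw [this, ← Finset.prod_mul_distrib]
      exact Finset.prod_congr rfl fun i _ => by ring
    have hP0 : ∏ i : Fin m, (s i - s m) ≠ 0 := Finset.prod_ne_zero_iff.2 fun i _ => hne i
    have hm1 : ((-1 : ℂ)) ^ m * (-1) ^ m = 1 := by rw [← mul_pow]; simp
    have hm0 : ((-1 : ℂ)) ^ m ≠ 0 := by simp
    rw [hintegral, hcongr, integral_const_mul, hdet, hdx, gpow_prod, rhs, hG, det_mul, det_mul,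
      det_diagonal, det_diagonal, hVsucc, Finset.prod_range_succ, Fin.prod_univ_castSucc
        (f := fun i => (Fin.lastCases (1 : ℂ) (fun i : Fin m => s i - s m) i : ℂ))]
    simp only [Fin.lastCases_castSucc, Fin.lastCases_last, mul_one]
    generalize (Matrix.of fun i c : Fin (m + 1) => (Fin.lastCases (1 : ℂ) (fun i : Fin m =>
          gpow (L i - L m) (s i - s m) (a c) / (s i - s m)) i : ℂ)).det = D
    generalize ∏ c, gpow (L m) (s m) (a c) = E
    generalize ∏ i : Fin m, (s i - s m) = P at hP0 ⊢
    generalize ((-1 : ℂ)) ^ m = e at hm1 hm0 ⊢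
    rw [div_mul_eq_mul_div, div_mul_eq_mul_div, div_eq_div_iff (by positivity) (by positivity)]
    linear_combination ((m.factorial : ℂ) * (∏ j ∈ Finset.range m, (Nat.factorial j : ℂ)) * D * E *
      (((vandermonde a).det : ℝ) : ℂ) * VdmC m s * P) * hm1

end RMT

namespace RMT

lemma general_formula {n : ℕ} {a : Fin n → ℝ} (ha : Function.Injective a) (ha0 : ∀ i, a i ≠ 0)
    (L : ℕ → ℤ) (s : ℕ → ℂ) (hs : ∀ j < n, 1 ≤ (s j - sNext n s j).re)
    {μ : Measure (Matrix (Fin n) (Fin n) ℂ)} (hμ : IsHaarUnitary n μ) :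
    Nsph n n μ s L (diagonal fun i => (a i : ℂ)) = rhs n L s a := by
  set σ := Tuple.sort a with hσ
  have hmono : StrictMono (a ∘ σ) :=
    (Tuple.monotone_sort a).strictMono_of_injective (ha.comp σ.injective)
  have h1 := sorted_formula n (a ∘ σ) hmono (fun i => ha0 _) L s hs μ hμ
  have h2 : Nsph n n μ s L (diagonal fun i => (a i : ℂ)) =
      Nsph n n μ s L (diagonal fun i => ((a ∘ σ) i : ℂ)) := by
    refine Nsph_congr hμ s L (isHermitian_diagonal_of_self_adjoint _ (by ext i; simp))
      (isHermitian_diagonal_of_self_adjoint _ (by ext i; simp)) ?_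
    rw [charpoly_diagonal, charpoly_diagonal]
    exact (Equiv.prod_comp σ (fun i => (Polynomial.X - Polynomial.C (a i : ℂ)))).symm
  rw [h2, h1, rhs, rhs]
  have e1 : (Matrix.of fun b c : Fin n => gpow (L b) (s b) ((a ∘ σ) c)) =
      (Matrix.of fun b c : Fin n => gpow (L b) (s b) (a c)).submatrix id σ := rfl
  have e2 : vandermonde (a ∘ σ) = (vandermonde a).submatrix σ id := rfl
  rw [e1, e2, det_permute', det_permute]
  rcases Int.units_eq_one_or (Equiv.Perm.sign σ) with h | h
  · simp [h]
  · simp [h]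

/-- Explicit Gelfand–Naĭmark-type formula for the unnormalized spherical
function `N_{n,n}(s, L; diag a)` on the invertible Hermitian matrices. -/
theorem statement0 (n : ℕ) (hn : 1 ≤ n) (a : ℕ → ℝ)
    (ha0 : ∀ i < n, a i ≠ 0)
    (hadist : ∀ i < n, ∀ j < n, i ≠ j → a i ≠ a j)
    (L : ℕ → ℤ) (hL : ∀ i < n, L i = 0 ∨ L i = 1)
    (s : ℕ → ℂ) (hsdist : ∀ i < n, ∀ j < n, i ≠ j → s i ≠ s j)
    (hs : ∀ j < n, 1 ≤ (s j - sNext n s j).re)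
    (μ : Measure (Matrix (Fin n) (Fin n) ℂ)) (hμ : IsHaarUnitary n μ) :
    Nsph n n μ s L (Matrix.diagonal fun i : Fin n => ((a i : ℝ) : ℂ)) =
      (∏ j ∈ Finset.range n, (Nat.factorial j : ℂ)) *
        Matrix.det (Matrix.of fun b c : Fin n =>
          ((Real.sign (a c) : ℝ) : ℂ) ^ (L b) * ((|a c| : ℝ) : ℂ) ^ (s b)) /
        (VdmC n (fun j => ((a j : ℝ) : ℂ)) * VdmC n s) := by
  have hinj : Function.Injective fun i : Fin n => a i := by
    intro i j h
    by_contra hij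
    exact hadist i i.2 j j.2 (fun h' => hij (Fin.ext h')) h
  have h := general_formula (a := fun i : Fin n => a i) hinj (fun i => ha0 i i.2) L s hs hμ
  rw [h, rhs, VdmC_eq (fun j => ((a j : ℝ) : ℂ)), vdm_ofReal]
  have e : (Matrix.of fun b c : Fin n => gpow (L b) (s b) (a c)) =
      (Matrix.of fun b c : Fin n =>
          ((Real.sign (a c) : ℝ) : ℂ) ^ (L b) * ((|a c| : ℝ) : ℂ) ^ (s b)) := by
    ext b c
    simp only [Matrix.of_apply, gpow, if_neg (ha0 c c.2)]
  rw [e]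

end RMT
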